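/- Let Ω ⊆ ℝⁿ, n ≥ 2, be open and bounded. Then the supremum of u*(t) / (N*_{|Ω|}(t) · ‖Δu‖_{L¹(Ω)}), taken over all u ∈ W^{2,1}_{Δ,0}(Ω) with Δu ≠ 0 and all t with 0 < t ≤ |Ω|, equals 2^{−2/n}. -/

import Mathlib

open MeasureTheory Filter Topology
open scoped ENNReal

noncomputable section

/-- Euclidean space ℝⁿ. -/
abbrev Euc (n : ℕ) := EuclideanSpace ℝ (Fin n)

/-- The (pointwise) Laplacian of a function on ℝⁿ: the trace of the second derivative. -/
def lapl (n : ℕ) (φ : Euc n → ℝ) (x : Euc n) : ℝ :=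
  ∑ i : Fin n,
    iteratedFDeriv ℝ 2 φ x ![EuclideanSpace.single i (1 : ℝ), EuclideanSpace.single i (1 : ℝ)]

/-- A test function on Ω: smooth and compactly supported inside Ω. -/
def IsTestFun (n : ℕ) (Ω : Set (Euc n)) (φ : Euc n → ℝ) : Prop :=
  ContDiff ℝ (⊤ : ℕ∞) φ ∧ HasCompactSupport φ ∧ tsupport φ ⊆ Ω

/-- `u ∈ W₀^{1,1}(Ω)`: `u` is an L¹(Ω) limit of test functions whose gradients converge
in L¹(Ω) (i.e. `u` is in the closure of C_c^∞(Ω) in the W^{1,1} norm). -/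
def MemW0_1_1 (n : ℕ) (Ω : Set (Euc n)) (u : Euc n → ℝ) : Prop :=
  IntegrableOn u Ω volume ∧
  ∃ φ : ℕ → Euc n → ℝ, (∀ k, IsTestFun n Ω (φ k)) ∧
    Tendsto (fun k => ∫ x in Ω, |φ k x - u x|) atTop (𝓝 0) ∧
    ∃ g : Euc n → Euc n →L[ℝ] ℝ,
      IntegrableOn (fun x => ‖g x‖) Ω volume ∧
      Tendsto (fun k => ∫ x in Ω, ‖fderiv ℝ (φ k) x - g x‖) atTop (𝓝 0)

/-- `u ∈ W^{2,1}_Δ(Ω)` with distributional Laplacian `f ∈ L¹(Ω)`. -/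
def MemW21Delta (n : ℕ) (Ω : Set (Euc n)) (u f : Euc n → ℝ) : Prop :=
  MemW0_1_1 n Ω u ∧ IntegrableOn f Ω volume ∧
    ∀ ψ : Euc n → ℝ, IsTestFun n Ω ψ →
      ∫ x in Ω, u x * lapl n ψ x = ∫ x in Ω, f x * ψ x

/-- `u ∈ W^{2,1}_{Δ,0}(Ω)` with Laplacian `f`: `u` is an L¹(Ω) limit of test functions `φ k`
with `Δ(φ k) → f` in L¹(Ω) (closure of C_c^∞(Ω) in the norm ‖Δu‖₁). -/
def MemW21Delta0 (n : ℕ) (Ω : Set (Euc n)) (u f : Euc n → ℝ) : Prop :=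
  IntegrableOn u Ω volume ∧ IntegrableOn f Ω volume ∧
  ∃ φ : ℕ → Euc n → ℝ, (∀ k, IsTestFun n Ω (φ k)) ∧
    Tendsto (fun k => ∫ x in Ω, |φ k x - u x|) atTop (𝓝 0) ∧
    Tendsto (fun k => ∫ x in Ω, |lapl n (φ k) x - f x|) atTop (𝓝 0)

/-- The decreasing rearrangement `u*(t)` of `u` on Ω. -/
def decRearr (n : ℕ) (Ω : Set (Euc n)) (u : Euc n → ℝ) (t : ℝ) : ℝ :=
  sInf {s : ℝ | 0 ≤ s ∧ volume {x ∈ Ω | s < |u x|} ≤ ENNReal.ofReal t}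

/-- `‖f‖_{L¹(Ω)}`. -/
def L1norm (n : ℕ) (Ω : Set (Euc n)) (f : Euc n → ℝ) : ℝ := ∫ x in Ω, |f x|

/-- ω_{n-1}: surface measure of the unit sphere in ℝⁿ. -/
def omegaS (n : ℕ) : ℝ := 2 * Real.pi ^ ((n : ℝ) / 2) / Real.Gamma ((n : ℝ) / 2)

/-- c_n = 1/((n-2) ω_{n-1}). -/
def cConst (n : ℕ) : ℝ := 1 / (((n : ℝ) - 2) * omegaS n)

/-- `N*_V(t)`: the rearrangement of the Green function of the ball of volume V. -/
def NstarV (n : ℕ) (V t : ℝ) : ℝ :=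
  if n = 2 then (1 / (4 * Real.pi)) * Real.log (V / t)
  else cConst n * (omegaS n / (n : ℝ)) ^ (((n : ℝ) - 2) / (n : ℝ)) *
    (t ^ (-(((n : ℝ) - 2) / (n : ℝ))) - V ^ (-(((n : ℝ) - 2) / (n : ℝ))))

/-- `N*_∞(t)` (for n ≥ 3). -/
def NstarInf (n : ℕ) (t : ℝ) : ℝ :=
  cConst n * (omegaS n / (n : ℝ)) ^ (((n : ℝ) - 2) / (n : ℝ)) *
    t ^ (-(((n : ℝ) - 2) / (n : ℝ)))

/-- The maximal function `u**(t) = (1/t) ∫₀ᵗ u*(s) ds`. -/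
def maximalFn (n : ℕ) (Ω : Set (Euc n)) (u : Euc n → ℝ) (t : ℝ) : ℝ :=
  (1 / t) * ∫ s in (0:ℝ)..t, decRearr n Ω u s

/-- `u ∈ L_exp(Ω)`. -/
def MemLexp (n : ℕ) (Ω : Set (Euc n)) (u : Euc n → ℝ) : Prop :=
  ∃ M : ℝ, ∀ t : ℝ, 0 < t → t ≤ (volume Ω).toReal →
    decRearr n Ω u t / (1 + Real.log ((volume Ω).toReal / t)) ≤ M

/-- `u ∈ L_{exp,0}(Ω)`. -/
def MemLexp0 (n : ℕ) (Ω : Set (Euc n)) (u : Euc n → ℝ) : Prop :=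
  MemLexp n Ω u ∧
    Tendsto (fun t : ℝ => maximalFn n Ω u t / Real.log (1 / t)) (𝓝[>] 0) (𝓝 0)

/-- `u ∈ L^{n/(n-2),∞}(Ω)`. -/
def MemWeakL (n : ℕ) (Ω : Set (Euc n)) (u : Euc n → ℝ) : Prop :=
  ∃ M : ℝ, ∀ t : ℝ, 0 < t → t ≤ (volume Ω).toReal →
    t ^ (((n : ℝ) - 2) / (n : ℝ)) * decRearr n Ω u t ≤ M

/-- `u ∈ L₀^{n/(n-2),∞}(Ω)`. -/
def MemWeakL0 (n : ℕ) (Ω : Set (Euc n)) (u : Euc n → ℝ) : Prop :=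
  MemWeakL n Ω u ∧
    Tendsto (fun t : ℝ => t ^ (((n : ℝ) - 2) / (n : ℝ)) * maximalFn n Ω u t) (𝓝[>] 0) (𝓝 0)

/-- `Λ_n^0(Ω)`: equals `L_{exp,0}(Ω)` if n = 2 and `L₀^{n/(n-2),∞}(Ω)` if n ≥ 3. -/
def MemLambda0 (n : ℕ) (Ω : Set (Euc n)) (u : Euc n → ℝ) : Prop :=
  if n = 2 then MemLexp0 n Ω u else MemWeakL0 n Ω u

/-- The one-dimensional Brunn–Minkowski inequality. -/
theorem volume_add_volume_le_of_add_subset {A B C : Set ℝ} (hA : MeasurableSet A)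
    (hB : MeasurableSet B) (hAne : A.Nonempty) (hBne : B.Nonempty)
    (h : ∀ x ∈ A, ∀ y ∈ B, x + y ∈ C) : volume A + volume B ≤ volume C := by
  have key : ∀ K ⊆ A, IsCompact K → K.Nonempty → ∀ L ⊆ B, IsCompact L → L.Nonempty →
      volume K + volume L ≤ volume C := by
    intro K hKA hK hKne L hLB hL hLne
    obtain ⟨a, haK, ha⟩ := hK.exists_isGreatest hKne
    obtain ⟨b, hbL, hb⟩ := hL.exists_isLeast hLne
    have h1 : volume ((fun x => x + b) '' K) = volume K := by
      simp [Set.image_add_right, measure_preimage_add_right]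
    have h2 : volume ((fun x => a + x) '' L) = volume L := by
      simp [Set.image_add_left, measure_preimage_add]
    rw [← h1, ← h2]
    have hdisj : AEDisjoint volume ((fun x => x + b) '' K) ((fun x => a + x) '' L) := by
      refine measure_mono_null (t := {a + b}) ?_ (by simp)
      rintro _ ⟨⟨x, hx, rfl⟩, ⟨y, hy, hxy⟩⟩
      have hx' := ha hx
      have hy' := hb hy
      simp only [Set.mem_singleton_iff] at *
      linarith
    rw [← measure_union₀ ((hL.image (by fun_prop)).measurableSet.nullMeasurableSet) hdisj]
    refine measure_mono ?_
    rintro _ (⟨x, hx, rfl⟩ | ⟨y, hy, rfl⟩)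
    · exact h _ (hKA hx) _ (hLB hbL)
    · exact h _ (hKA haK) _ (hLB hy)
  obtain ⟨a₀, ha₀⟩ := hAne
  obtain ⟨b₀, hb₀⟩ := hBne
  have hsup : ∀ {S : Set ℝ} (s₀ : ℝ), MeasurableSet S → s₀ ∈ S →
      volume S = ⨆ K : {K : Set ℝ // K ⊆ S ∧ IsCompact K ∧ K.Nonempty}, volume K.1 := by
    intro S s₀ hS hs₀
    refine le_antisymm ?_ (iSup_le fun K => measure_mono K.2.1)
    rw [hS.measure_eq_iSup_isCompact]
    refine iSup_le fun K => iSup_le fun hK => iSup_le fun hKc => ?_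
    refine (measure_mono (Set.subset_insert s₀ K)).trans ?_
    exact le_iSup (fun K : {K : Set ℝ // K ⊆ S ∧ IsCompact K ∧ K.Nonempty} => volume K.1)
      ⟨insert s₀ K, Set.insert_subset hs₀ hK, hKc.insert s₀, Set.insert_nonempty _ _⟩
  rw [hsup a₀ hA ha₀, hsup b₀ hB hb₀]
  have : Nonempty {K : Set ℝ // K ⊆ A ∧ IsCompact K ∧ K.Nonempty} :=
    ⟨{a₀}, by simpa using ha₀, isCompact_singleton, Set.singleton_nonempty _⟩
  have : Nonempty {K : Set ℝ // K ⊆ B ∧ IsCompact K ∧ K.Nonempty} :=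
    ⟨{b₀}, by simpa using hb₀, isCompact_singleton, Set.singleton_nonempty _⟩
  exact ENNReal.iSup_add_iSup_le fun K L =>
    key K.1 K.2.1 K.2.2.1 K.2.2.2 L.1 L.2.1 L.2.2.1 L.2.2.2

theorem ENNReal.geom_mean_le_arith_mean2_weighted {p q : ℝ} (hp : 0 < p) (hq : 0 < q)
    (hpq : p + q = 1) (a b : ℝ≥0∞) :
    a ^ p * b ^ q ≤ ENNReal.ofReal p * a + ENNReal.ofReal q * b := by
  have hp' : ENNReal.ofReal p ≠ 0 := by simpa using hp
  have hq' : ENNReal.ofReal q ≠ 0 := by simpa using hq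
  rcases eq_or_ne a ∞ with rfl | ha
  · rw [ENNReal.mul_top hp', top_add]; exact le_top
  rcases eq_or_ne b ∞ with rfl | hb
  · rw [ENNReal.mul_top hq', add_top]; exact le_top
  lift a to NNReal using ha
  lift b to NNReal using hb
  have := NNReal.geom_mean_le_arith_mean2_weighted p.toNNReal q.toNNReal a b
    (by rw [← Real.toNNReal_add hp.le hq.le, hpq, Real.toNNReal_one])
  rw [Real.coe_toNNReal _ hp.le, Real.coe_toNNReal _ hq.le] at this
  rw [← ENNReal.coe_rpow_of_nonneg _ hp.le, ← ENNReal.coe_rpow_of_nonneg _ hq.le]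
  rw [ENNReal.ofReal, ENNReal.ofReal]
  exact_mod_cast this

theorem lintegral_eq_lintegral_meas_lt_of_le_one {α : Type*} [MeasurableSpace α] (μ : Measure α)
    {f : α → ℝ≥0∞} (hf : Measurable f) (hf1 : ∀ x, f x ≤ 1) :
    ∫⁻ x, f x ∂μ = ∫⁻ t in Set.Ioi (0 : ℝ), μ {x | ENNReal.ofReal t < f x} := by
  have hfin : ∀ x, f x ≠ ∞ := fun x => ((hf1 x).trans_lt ENNReal.one_lt_top).ne
  have := lintegral_eq_lintegral_meas_lt (f := fun x => (f x).toReal) μ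
    (Eventually.of_forall fun x => ENNReal.toReal_nonneg) hf.ennreal_toReal.aemeasurable
  simp only [ENNReal.ofReal_toReal (hfin _)] at this
  rw [this]
  refine setLIntegral_congr_fun measurableSet_Ioi fun t ht => ?_
  congr 1
  ext x
  simp only [Set.mem_ofPred_eq]
  rw [ENNReal.ofReal_lt_iff_lt_toReal (le_of_lt ht) (hfin x)]

open scoped Pointwise in
/-- The Prékopa–Leindler inequality on the line for functions with supremum `1`, in its
arithmetic form. -/
theorem prekopaLeindler_real_of_iSup_eq_one {p q : ℝ} (hp : 0 < p) (hq : 0 < q) (hpq : p + q = 1)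
    {f g h : ℝ → ℝ≥0∞} (hf : Measurable f) (hg : Measurable g) (hh : Measurable h)
    (hf1 : ⨆ x, f x = 1) (hg1 : ⨆ x, g x = 1)
    (H : ∀ x y, f x ^ p * g y ^ q ≤ h (p * x + q * y)) :
    ENNReal.ofReal p * (∫⁻ x, f x) + ENNReal.ofReal q * ∫⁻ x, g x ≤ ∫⁻ x, h x := by
  have hfle : ∀ x, f x ≤ 1 := fun x => hf1 ▸ le_iSup f x
  have hgle : ∀ x, g x ≤ 1 := fun x => hg1 ▸ le_iSup g x
  have hm : ∀ {k : ℝ → ℝ≥0∞}, Measurable fun t : ℝ => volume {x | ENNReal.ofReal t < k x} := by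
    intro k
    exact Antitone.measurable fun s t hst => measure_mono fun x (hx : ENNReal.ofReal t < k x) =>
      (ENNReal.ofReal_le_ofReal hst).trans_lt hx
  calc ENNReal.ofReal p * (∫⁻ x, f x) + ENNReal.ofReal q * ∫⁻ x, g x
      = ∫⁻ t in Set.Ioi (0 : ℝ), (ENNReal.ofReal p * volume {x | ENNReal.ofReal t < f x} +
          ENNReal.ofReal q * volume {x | ENNReal.ofReal t < g x}) := by
        rw [lintegral_eq_lintegral_meas_lt_of_le_one volume hf hfle,
          lintegral_eq_lintegral_meas_lt_of_le_one volume hg hgle,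
          lintegral_add_left (hm.const_mul _), lintegral_const_mul _ hm, lintegral_const_mul _ hm]
    _ ≤ ∫⁻ t in Set.Ioi (0 : ℝ), volume {x | ENNReal.ofReal t < min (h x) 1} := by
        refine setLIntegral_mono hm fun t (ht : 0 < t) => ?_
        rcases le_or_gt 1 t with ht1 | ht1
        · have h1 : ∀ {k : ℝ → ℝ≥0∞}, (∀ x, k x ≤ 1) → {x | ENNReal.ofReal t < k x} = ∅ := by
            intro k hk
            ext x
            simp only [Set.mem_ofPred_eq, Set.mem_empty_iff_false, iff_false, not_lt]
            exact (hk x).trans (by simpa using ht1)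
          simp [h1 hfle, h1 hgle]
        · have ht1' : ENNReal.ofReal t < 1 := by simpa using ht1
          have hne : ∀ {k : ℝ → ℝ≥0∞}, ⨆ x, k x = 1 → {x | ENNReal.ofReal t < k x}.Nonempty := by
            intro k hk
            rw [← hk] at ht1'
            exact lt_iSup_iff.mp ht1'
          have hs : ∀ {r : ℝ} (_ : 0 < r) (S : Set ℝ),
              ENNReal.ofReal r * volume S = volume (r • S) := by
            intro r hr S
            rw [Measure.addHaar_smul]
            simp [abs_of_pos hr]
          rw [hs hp, hs hq]
          refine volume_add_volume_le_of_add_subset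
            ((hf measurableSet_Ioi).const_smul_of_ne_zero hp.ne')
            ((hg measurableSet_Ioi).const_smul_of_ne_zero hq.ne')
            ((hne hf1).smul_set) ((hne hg1).smul_set) ?_
          rintro _ ⟨x, hx, rfl⟩ _ ⟨y, hy, rfl⟩
          simp only [Set.mem_ofPred_eq, lt_min_iff] at hx hy ⊢
          refine ⟨lt_of_lt_of_le ?_ (H x y), ht1'⟩
          have htop : ENNReal.ofReal t ≠ ∞ := ENNReal.ofReal_ne_top
          have ht0 : ENNReal.ofReal t ≠ 0 := by simpa using ht
          calc ENNReal.ofReal t = ENNReal.ofReal t ^ p * ENNReal.ofReal t ^ q := by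
                rw [← ENNReal.rpow_add _ _ ht0 htop, hpq, ENNReal.rpow_one]
            _ < f x ^ p * g y ^ q :=
                ENNReal.mul_lt_mul (ENNReal.rpow_lt_rpow hx hp) (ENNReal.rpow_lt_rpow hy hq)
    _ = ∫⁻ x, min (h x) 1 :=
        (lintegral_eq_lintegral_meas_lt_of_le_one _ (hh.min measurable_const)
          fun x => min_le_right _ _).symm
    _ ≤ ∫⁻ x, h x := lintegral_mono fun x => min_le_left _ _

theorem prekopaLeindler_real {p q : ℝ} (hp : 0 < p) (hq : 0 < q) (hpq : p + q = 1)
    {f g h : ℝ → ℝ≥0∞} (hf : Measurable f) (hg : Measurable g) (hh : Measurable h)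
    (H : ∀ x y, f x ^ p * g y ^ q ≤ h (p * x + q * y)) :
    (∫⁻ x, f x) ^ p * (∫⁻ x, g x) ^ q ≤ ∫⁻ x, h x := by
  have bdd : ∀ f g : ℝ → ℝ≥0∞, Measurable f → Measurable g → ⨆ x, f x ≠ ∞ → ⨆ x, g x ≠ ∞ →
      (∀ x y, f x ^ p * g y ^ q ≤ h (p * x + q * y)) →
      (∫⁻ x, f x) ^ p * (∫⁻ x, g x) ^ q ≤ ∫⁻ x, h x := by
    intro f g hf hg hF hG H
    set F := ⨆ x, f x with hFdef
    set G := ⨆ x, g x with hGdef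
    rcases eq_or_ne F 0 with hF0 | hF0
    · have : ∀ x, f x = 0 := fun x => by
        have := le_iSup f x
        rw [← hFdef, hF0] at this
        simpa using this
      simp [this, hp]
    rcases eq_or_ne G 0 with hG0 | hG0
    · have : ∀ x, g x = 0 := fun x => by
        have := le_iSup g x
        rw [← hGdef, hG0] at this
        simpa using this
      simp [this, hq]
    have hFp0 : F ^ p ≠ 0 := by simp [hF0, hF]
    have hFpt : F ^ p ≠ ∞ := by simp [hF0, hF]
    have hGp0 : G ^ q ≠ 0 := by simp [hG0, hG]
    have hGpt : G ^ q ≠ ∞ := by simp [hG0, hG]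
    have key := prekopaLeindler_real_of_iSup_eq_one hp hq hpq (f := fun x => F⁻¹ * f x)
      (g := fun x => G⁻¹ * g x) (h := fun x => ((F ^ p)⁻¹ * (G ^ q)⁻¹) * h x) (hf.const_mul _)
      (hg.const_mul _) (hh.const_mul _)
      (by rw [← ENNReal.mul_iSup, ← hFdef, ENNReal.inv_mul_cancel hF0 hF])
      (by rw [← ENNReal.mul_iSup, ← hGdef, ENNReal.inv_mul_cancel hG0 hG]) (by
        intro x y
        rw [ENNReal.mul_rpow_of_nonneg _ _ hp.le, ENNReal.mul_rpow_of_nonneg _ _ hq.le,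
          ENNReal.inv_rpow, ENNReal.inv_rpow]
        calc _ = ((F ^ p)⁻¹ * (G ^ q)⁻¹) * (f x ^ p * g y ^ q) := by ring
          _ ≤ _ := by gcongr; exact H x y)
    replace key := (ENNReal.geom_mean_le_arith_mean2_weighted hp hq hpq _ _).trans key
    rw [lintegral_const_mul _ hf, lintegral_const_mul _ hg, lintegral_const_mul _ hh,
      ENNReal.mul_rpow_of_nonneg _ _ hp.le, ENNReal.mul_rpow_of_nonneg _ _ hq.le,
          ENNReal.inv_rpow, ENNReal.inv_rpow] at key
    have := mul_le_mul_right key (F ^ p * G ^ q)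
    calc _ = (F ^ p * (F ^ p)⁻¹) * (G ^ q * (G ^ q)⁻¹) *
          ((∫⁻ x, f x) ^ p * (∫⁻ x, g x) ^ q) := by
          rw [ENNReal.mul_inv_cancel hFp0 hFpt, ENNReal.mul_inv_cancel hGp0 hGpt]; ring
      _ = (F ^ p * G ^ q) *
          ((F ^ p)⁻¹ * (∫⁻ x, f x) ^ p * ((G ^ q)⁻¹ * (∫⁻ x, g x) ^ q)) := by ring
      _ ≤ _ := this
      _ = (F ^ p * (F ^ p)⁻¹) * (G ^ q * (G ^ q)⁻¹) * ∫⁻ x, h x := by ring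
      _ = _ := by
          rw [ENNReal.mul_inv_cancel hFp0 hFpt, ENNReal.mul_inv_cancel hGp0 hGpt]; ring
  have hlim : ∀ k : ℝ → ℝ≥0∞, Measurable k →
      Tendsto (fun m : ℕ => ∫⁻ x, min (k x) m) atTop (𝓝 (∫⁻ x, k x)) := by
    intro k hk
    refine lintegral_tendsto_of_tendsto_of_monotone
      (fun m => (hk.min measurable_const).aemeasurable)
      (Eventually.of_forall fun x a b hab => min_le_min le_rfl (by exact_mod_cast hab))
      (Eventually.of_forall fun x => ?_)
    simpa using (tendsto_const_nhds (x := k x)).min ENNReal.tendsto_nat_nhds_top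
  have hcut : ∀ k : ℝ → ℝ≥0∞, ∀ m : ℕ, ⨆ x, min (k x) (m : ℝ≥0∞) ≠ ∞ := fun k m =>
    ((iSup_le fun x => min_le_right _ _).trans_lt (ENNReal.natCast_lt_top m)).ne
  have step : ∀ m₁ m₂ : ℕ,
      (∫⁻ x, min (f x) m₁) ^ p * (∫⁻ x, min (g x) m₂) ^ q ≤ ∫⁻ x, h x := fun m₁ m₂ =>
    bdd _ _ (hf.min measurable_const) (hg.min measurable_const) (hcut f m₁) (hcut g m₂)
      fun x y => le_trans (by gcongr <;> exact min_le_left _ _) (H x y)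
  have hsupf : ∀ k : ℝ → ℝ≥0∞, Measurable k → ∀ r : ℝ, 0 < r →
      (∫⁻ x, k x) ^ r = ⨆ m : ℕ, (∫⁻ x, min (k x) m) ^ r := by
    intro k hk r hr
    have hmono : Monotone fun m : ℕ => (∫⁻ x, min (k x) m) ^ r := fun a b hab => by
      dsimp only; gcongr
    exact tendsto_nhds_unique ((hlim k hk).ennrpow_const r) (tendsto_atTop_iSup hmono)
  rw [hsupf f hf p hp, hsupf g hg q hq, ENNReal.iSup_mul]
  refine iSup_le fun m₁ => ?_
  rw [ENNReal.mul_iSup]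
  exact iSup_le fun m₂ => step m₁ m₂

/-- The Prékopa–Leindler inequality. -/
theorem prekopaLeindler {p q : ℝ} (hp : 0 < p) (hq : 0 < q) (hpq : p + q = 1) (n : ℕ)
    {f g h : (Fin n → ℝ) → ℝ≥0∞} (hf : Measurable f) (hg : Measurable g) (hh : Measurable h)
    (H : ∀ x y, f x ^ p * g y ^ q ≤ h (p • x + q • y)) :
    (∫⁻ x, f x) ^ p * (∫⁻ x, g x) ^ q ≤ ∫⁻ x, h x := by
  induction n with
  | zero =>
    have : ∀ k : (Fin 0 → ℝ) → ℝ≥0∞, ∫⁻ x, k x = k 0 := by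
      intro k
      rw [lintegral_unique, volume_pi, Measure.pi_of_empty _ 0]
      simp only [measure_univ, mul_one]
      congr 1
      exact Subsingleton.elim _ _
    simp only [this]
    simpa using H 0 0
  | succ n ih =>
    have hms : ∀ {k : (Fin (n + 1) → ℝ) → ℝ≥0∞}, Measurable k →
        Measurable fun z : ℝ × (Fin n → ℝ) => k (Fin.cons z.1 z.2) := by
      intro k hk
      refine hk.comp ?_
      have := (MeasurableEquiv.piFinSuccAbove (fun _ : Fin (n + 1) => ℝ) 0).symm.measurable
      simpa [MeasurableEquiv.piFinSuccAbove, Fin.insertNthEquiv] using this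
    have hfub : ∀ {k : (Fin (n + 1) → ℝ) → ℝ≥0∞}, Measurable k →
        ∫⁻ x, k x = ∫⁻ s : ℝ, ∫⁻ x : Fin n → ℝ, k (Fin.cons s x) := by
      intro k hk
      have h1 := (volume_preserving_piFinSuccAbove (fun _ : Fin (n + 1) => ℝ) 0).symm
      rw [← h1.lintegral_comp hk, Measure.volume_eq_prod, lintegral_prod
        (fun z => k ((MeasurableEquiv.piFinSuccAbove (fun _ : Fin (n + 1) => ℝ) 0).symm z))
        ((hk.comp h1.measurable).aemeasurable)]
      simp [MeasurableEquiv.piFinSuccAbove, Fin.insertNthEquiv]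
    rw [hfub hf, hfub hg, hfub hh]
    refine prekopaLeindler_real hp hq hpq (hms hf).lintegral_prod_right'
      (hms hg).lintegral_prod_right' (hms hh).lintegral_prod_right' fun s t => ?_
    refine ih ((hms hf).comp measurable_prodMk_left) ((hms hg).comp measurable_prodMk_left)
      ((hms hh).comp measurable_prodMk_left) fun x y => ?_
    convert H (Fin.cons s x) (Fin.cons t y) using 2
    ext i
    refine Fin.cases ?_ (fun i => ?_) i <;> simp

/-- The volume of the unit ball of ℝⁿ. -/
def unitBallVol (n : ℕ) : ℝ := volume.real (Metric.ball (0 : Euc n) 1)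

theorem unitBallVol_pos (n : ℕ) : 0 < unitBallVol n :=
  ENNReal.toReal_pos (Metric.measure_ball_pos volume _ one_pos).ne' measure_ball_lt_top.ne

theorem volume_real_ball (n : ℕ) (x : Euc n) {r : ℝ} (hr : 0 < r) :
    volume.real (Metric.ball x r) = r ^ n * unitBallVol n := by
  rw [measureReal_def, Measure.addHaar_ball_of_pos _ _ hr]
  simp [unitBallVol, measureReal_def, hr.le]

theorem unitBallVol_eq {n : ℕ} (hn : 0 < n) : unitBallVol n = omegaS n / n := by
  have : Nonempty (Fin n) := ⟨⟨0, hn⟩⟩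
  have hn' : (0 : ℝ) < n := by exact_mod_cast hn
  have hG : 0 < Real.Gamma ((n : ℝ) / 2) := Real.Gamma_pos_of_pos (by positivity)
  rw [unitBallVol, measureReal_def, EuclideanSpace.volume_ball, omegaS]
  simp only [ENNReal.ofReal_one, one_pow, one_mul, Fintype.card_fin]
  rw [ENNReal.toReal_ofReal (by positivity), Real.Gamma_add_one (by positivity),
    Real.sqrt_eq_rpow, ← Real.rpow_mul_natCast Real.pi_pos.le]
  rw [show (1 / 2 * (n : ℝ)) = n / 2 by ring]
  field_simp

/-- The Brunn–Minkowski inequality in multiplicative form. -/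
theorem volume_rpow_mul_volume_rpow_le {p q : ℝ} (hp : 0 < p) (hq : 0 < q) (hpq : p + q = 1)
    {n : ℕ} {A B C : Set (Euc n)} (hA : MeasurableSet A) (hB : MeasurableSet B)
    (hC : MeasurableSet C) (h : ∀ x ∈ A, ∀ y ∈ B, p • x + q • y ∈ C) :
    volume A ^ p * volume B ^ q ≤ volume C := by
  have hvol : ∀ {S : Set (Euc n)}, MeasurableSet S →
      volume S = ∫⁻ x : Fin n → ℝ, S.indicator 1 (WithLp.toLp 2 x) := by
    intro S hS
    rw [(PiLp.volume_preserving_toLp (Fin n)).lintegral_comp (measurable_one.indicator hS),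
      lintegral_indicator_one hS]
  have hm : ∀ {S : Set (Euc n)}, MeasurableSet S →
      Measurable fun x : Fin n → ℝ => S.indicator (1 : Euc n → ℝ≥0∞) (WithLp.toLp 2 x) := fun hS =>
    (measurable_one.indicator hS).comp (PiLp.volume_preserving_toLp (Fin n)).measurable
  rw [hvol hA, hvol hB, hvol hC]
  refine prekopaLeindler hp hq hpq n (hm hA) (hm hB) (hm hC) fun x y => ?_
  by_cases hx : WithLp.toLp 2 x ∈ A
  · by_cases hy : WithLp.toLp 2 y ∈ B
    · have := h _ hx _ hy
      simp [hx, hy, this]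
    · simp [hy, hq]
  · simp [hx, hp]

open scoped Pointwise in
/-- The Brunn–Minkowski inequality for the sum of a set and a ball. -/
theorem ofReal_add_pow_le_volume {n : ℕ} (hn : 0 < n) {A C : Set (Euc n)} (hA : MeasurableSet A)
    (hC : MeasurableSet C) {ε : ℝ} (hε : 0 < ε) (h0 : volume A ≠ 0) (ht : volume A ≠ ∞)
    (h : ∀ x ∈ A, Metric.ball x ε ⊆ C) :
    ENNReal.ofReal ((volume.real A ^ (1 / (n : ℝ)) + ε * unitBallVol n ^ (1 / (n : ℝ))) ^ n) ≤
      volume C := by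
  have hn' : (n : ℝ) ≠ 0 := by exact_mod_cast hn.ne'
  set a := volume.real A ^ (1 / (n : ℝ)) with ha
  set b := unitBallVol n ^ (1 / (n : ℝ)) with hb
  have hA0 : 0 < volume.real A := ENNReal.toReal_pos h0 ht
  have ha0 : 0 < a := Real.rpow_pos_of_pos hA0 _
  have hb0 : 0 < b := Real.rpow_pos_of_pos (unitBallVol_pos n) _
  have han : a ^ n = volume.real A := by
    rw [ha, ← Real.rpow_mul_natCast hA0.le, one_div_mul_cancel hn', Real.rpow_one]
  have hbn : b ^ n = unitBallVol n := by
    rw [hb, ← Real.rpow_mul_natCast (unitBallVol_pos n).le, one_div_mul_cancel hn', Real.rpow_one]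
  set c := a + ε * b with hc
  have hc0 : 0 < c := by positivity
  have hp : 0 < a / c := by positivity
  have hq : 0 < ε * b / c := by positivity
  have hpq : a / c + ε * b / c = 1 := by rw [← add_div, div_self hc0.ne']
  have hvA : volume ((a / c)⁻¹ • A) = ENNReal.ofReal (c ^ n) := by
    rw [Measure.addHaar_smul, finrank_euclideanSpace_fin, ← ENNReal.ofReal_toReal ht,
      ← measureReal_def, ← han, ← ENNReal.ofReal_mul (abs_nonneg _),
      abs_of_pos (by positivity), ← mul_pow]
    congr 2
    field_simp
  have hvB : volume (Metric.ball (0 : Euc n) (c / b)) = ENNReal.ofReal (c ^ n) := by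
    rw [← ENNReal.ofReal_toReal (measure_ball_lt_top (μ := volume)).ne, ← measureReal_def,
      volume_real_ball _ _ (by positivity), ← hbn, ← mul_pow]
    congr 2
    field_simp
  have key := volume_rpow_mul_volume_rpow_le hp hq hpq
    (hA.const_smul_of_ne_zero (inv_ne_zero hp.ne')) measurableSet_ball hC
    (B := Metric.ball (0 : Euc n) (c / b)) (by
      rintro _ ⟨x, hx, rfl⟩ y hy
      refine h x hx ?_
      dsimp only
      rw [smul_inv_smul₀ hp.ne', Metric.mem_ball, dist_eq_norm, add_sub_cancel_left, norm_smul,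
        Real.norm_of_nonneg hq.le]
      rw [mem_ball_zero_iff] at hy
      calc ε * b / c * ‖y‖ < ε * b / c * (c / b) := by gcongr
        _ = ε := by field_simp)
  have hcn : ENNReal.ofReal (c ^ n) ≠ 0 := by simpa using pow_pos hc0 n
  rwa [hvA, hvB, ← ENNReal.rpow_add _ _ hcn ENNReal.ofReal_ne_top, hpq, ENNReal.rpow_one] at key

/-- Linearised Brunn–Minkowski inequality for the parallel sets of a set. -/
theorem volume_real_add_le_volume {n : ℕ} (hn : 0 < n) {A C : Set (Euc n)}
    (hA : MeasurableSet A)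
    (hC : MeasurableSet C) {ε m : ℝ} (hε : 0 < ε) (hm : 0 < m) (hmA : m ≤ volume.real A)
    (h : ∀ x ∈ A, Metric.ball x ε ⊆ C) :
    volume A + ENNReal.ofReal
        (ε * (n * unitBallVol n ^ (1 / (n : ℝ)) * m ^ (1 - 1 / (n : ℝ)))) ≤ volume C := by
  have hn' : (n : ℝ) ≠ 0 := by exact_mod_cast hn.ne'
  have hA0 : 0 < volume.real A := hm.trans_le hmA
  have h0 : volume A ≠ 0 := fun h => by simp [measureReal_def, h] at hA0
  have ht : volume A ≠ ∞ := fun h => by simp [measureReal_def, h] at hA0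
  refine le_trans ?_ (ofReal_add_pow_le_volume hn hA hC hε h0 ht h)
  rw [← ENNReal.ofReal_toReal ht, ← measureReal_def, ← ENNReal.ofReal_add hA0.le (by
    have := unitBallVol_pos n
    positivity)]
  refine ENNReal.ofReal_le_ofReal ?_
  set V := volume.real A
  set a := V ^ (1 / (n : ℝ)) with ha
  set b := unitBallVol n ^ (1 / (n : ℝ)) with hb
  have ha0 : 0 < a := Real.rpow_pos_of_pos hA0 _
  have hb0 : 0 < b := Real.rpow_pos_of_pos (unitBallVol_pos n) _
  have han : a ^ n = V := by
    rw [ha, ← Real.rpow_mul_natCast hA0.le, one_div_mul_cancel hn', Real.rpow_one]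
  have han1 : V ^ (1 - 1 / (n : ℝ)) = a ^ n / a := by
    rw [Real.rpow_sub hA0, Real.rpow_one, han]
  have hmV : m ^ (1 - 1 / (n : ℝ)) ≤ a ^ n / a := by
    rw [← han1]
    refine Real.rpow_le_rpow hm.le hmA ?_
    have : (1 : ℝ) ≤ n := by exact_mod_cast hn
    rw [sub_nonneg, div_le_one (by positivity)]
    exact this
  have bern := one_add_mul_le_pow (a := ε * b / a) (by
    have : 0 < ε * b / a := by positivity
    linarith) n
  calc V + ε * (n * b * m ^ (1 - 1 / (n : ℝ))) ≤ a ^ n + ε * (n * b * (a ^ n / a)) := by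
        rw [han]; gcongr; rwa [han] at hmV
    _ = a ^ n * (1 + n * (ε * b / a)) := by field_simp
    _ ≤ a ^ n * (1 + ε * b / a) ^ n := by gcongr
    _ = (a + ε * b) ^ n := by rw [← mul_pow]; congr 1; field_simp

/-- A co-area type lower bound: if all superlevel sets `{w > τ}`, `0 ≤ τ < G`, have measure at
least `m`, then the total variation of `w` is at least `G` times the perimeter of a ball of
measure `m`. -/
theorem mul_le_integral_norm_fderiv {n : ℕ} (hn : 0 < n) {w : Euc n → ℝ} (hw : ContDiff ℝ 1 w)
    (hc : HasCompactSupport w) (hw0 : ∀ x, 0 ≤ w x) {G m : ℝ} (hm : 0 < m)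
    (h : ∀ τ, 0 ≤ τ → τ < G → m ≤ volume.real {x | τ < w x}) :
    n * unitBallVol n ^ (1 / (n : ℝ)) * m ^ (1 - 1 / (n : ℝ)) * G ≤ ∫ x, ‖fderiv ℝ w x‖ := by
  set κ := n * unitBallVol n ^ (1 / (n : ℝ)) * m ^ (1 - 1 / (n : ℝ)) with hκ
  have hκ0 : 0 ≤ κ := by
    have := (unitBallVol_pos n).le
    positivity
  have hDc : Continuous fun x => ‖fderiv ℝ w x‖ := (hw.continuous_fderiv one_ne_zero).norm
  have hDs : HasCompactSupport fun x => ‖fderiv ℝ w x‖ := (hc.fderiv ℝ).norm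
  have hDi : Integrable fun x => ‖fderiv ℝ w x‖ := hDc.integrable_of_hasCompactSupport hDs
  have hDu := hDs.uniformContinuous_of_continuous hDc
  set K := Metric.cthickening 1 (tsupport w) with hK
  have hKc : IsCompact K := hc.isCompact.cthickening
  have hKm : MeasurableSet K := hKc.isClosed.measurableSet
  have hKt : volume K ≠ ∞ := hKc.measure_lt_top.ne
  have hwi : Integrable w := hw.continuous.integrable_of_hasCompactSupport hc
  have main : ∀ η : ℝ, 0 < η → κ * G ≤ (∫ x, ‖fderiv ℝ w x‖) + η * volume.real K := by
    intro η hη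
    obtain ⟨δ, hδ, hδD⟩ := Metric.uniformContinuous_iff.1 hDu η hη
    set ε := min δ 1 with hε
    have hε0 : 0 < ε := lt_min hδ one_pos
    set h1 : Euc n → ℝ := K.indicator fun x => ε * (‖fderiv ℝ w x‖ + η) with hh1
    have h1m : Measurable h1 := ((hDc.measurable.add_const η).const_mul ε).indicator hKm
    have h10 : ∀ x, 0 ≤ h1 x := fun x => Set.indicator_nonneg (fun y _ => by positivity) x
    have hball : ∀ τ, 0 ≤ τ → ∀ x ∈ {x | τ < w x}, Metric.ball x ε ⊆ {x | τ < w x + h1 x} := by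
      intro τ hτ x hx y hy
      rw [Set.mem_ofPred_eq] at hx ⊢
      have hxs : x ∈ tsupport w := subset_tsupport _ (by
        rw [Function.mem_support]; exact (hτ.trans_lt hx).ne')
      have hyK : y ∈ K := Metric.mem_cthickening_of_dist_le y x 1 _ hxs
        ((Metric.mem_ball.1 hy).le.trans (min_le_right _ _))
      rw [hh1, Set.indicator_of_mem hyK]
      have hxy : x ∈ Metric.ball y ε := Metric.mem_ball_comm.1 hy
      have hmv := (convex_ball y ε).norm_image_sub_le_of_norm_fderiv_le (𝕜 := ℝ) (f := w)
        (C := ‖fderiv ℝ w y‖ + η) (fun z _ => hw.differentiable one_ne_zero z)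
        (fun z hz => by
          have := hδD (a := z) (b := y) ((Metric.mem_ball.1 hz).trans_le (min_le_left _ _))
          rw [Real.dist_eq] at this
          linarith [(abs_lt.1 this).2]) (Metric.mem_ball_self hε0) hxy
      rw [Metric.mem_ball, dist_eq_norm] at hxy
      have h2 : (‖fderiv ℝ w y‖ + η) * ‖x - y‖ ≤ ε * (‖fderiv ℝ w y‖ + η) := by
        rw [mul_comm]; gcongr
      have h3 := (Real.norm_eq_abs _ ▸ le_abs_self (w x - w y)).trans (hmv.trans h2)
      linarith
    have hlev : ∀ τ ∈ Set.Ioi (0 : ℝ), volume {x | τ < w x} +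
        (Set.Iio G).indicator (fun _ => ENNReal.ofReal (ε * κ)) τ ≤
          volume {x | τ < w x + h1 x} := by
      intro τ hτ
      by_cases hτG : τ < G
      · rw [Set.indicator_of_mem (Set.mem_Iio.2 hτG)]
        exact volume_real_add_le_volume hn (measurableSet_lt measurable_const hw.continuous.measurable)
          (measurableSet_lt measurable_const (hw.continuous.measurable.add h1m)) hε0 hm
          (h τ (Set.mem_Ioi.1 hτ).le hτG) (hball τ (Set.mem_Ioi.1 hτ).le)
      · rw [Set.indicator_of_notMem (by simpa using hτG), add_zero]
        exact measure_mono fun x hx => lt_of_lt_of_le hx (le_add_of_nonneg_right (h10 x))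
    have hint : (∫⁻ x, ENNReal.ofReal (w x)) + ENNReal.ofReal (ε * κ) * ENNReal.ofReal G ≤
        (∫⁻ x, ENNReal.ofReal (w x)) + ∫⁻ x, ENNReal.ofReal (h1 x) := by
      calc (∫⁻ x, ENNReal.ofReal (w x)) + ENNReal.ofReal (ε * κ) * ENNReal.ofReal G
          = (∫⁻ τ in Set.Ioi (0 : ℝ), volume {x | τ < w x}) + ∫⁻ τ in Set.Ioi (0 : ℝ),
              (Set.Iio G).indicator (fun _ => ENNReal.ofReal (ε * κ)) τ := by
            rw [lintegral_eq_lintegral_meas_lt volume (Eventually.of_forall hw0)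
              hw.continuous.aemeasurable, lintegral_indicator measurableSet_Iio,
              Measure.restrict_restrict measurableSet_Iio, setLIntegral_const,
              Set.inter_comm, Set.Ioi_inter_Iio, Real.volume_Ioo, sub_zero]
        _ = ∫⁻ τ in Set.Ioi (0 : ℝ), (volume {x | τ < w x} +
              (Set.Iio G).indicator (fun _ => ENNReal.ofReal (ε * κ)) τ) := by
            rw [lintegral_add_right _ (measurable_const.indicator measurableSet_Iio)]
        _ ≤ ∫⁻ τ in Set.Ioi (0 : ℝ), volume {x | τ < w x + h1 x} :=
            setLIntegral_mono' measurableSet_Ioi hlev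
        _ = ∫⁻ x, ENNReal.ofReal (w x + h1 x) :=
            (lintegral_eq_lintegral_meas_lt volume
              (Eventually.of_forall fun x => add_nonneg (hw0 x) (h10 x))
              (hw.continuous.measurable.add h1m).aemeasurable).symm
        _ = _ := by
            rw [← lintegral_add_right _ h1m.ennreal_ofReal]
            exact lintegral_congr fun x => ENNReal.ofReal_add (hw0 x) (h10 x)
    have hwfin : (∫⁻ x, ENNReal.ofReal (w x)) ≠ ∞ := by
      rw [← ofReal_integral_eq_lintegral_ofReal hwi (Eventually.of_forall hw0)]
      exact ENNReal.ofReal_ne_top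
    have hint2 := (ENNReal.add_le_add_iff_left hwfin).1 hint
    have hgi : IntegrableOn (fun x => ε * (‖fderiv ℝ w x‖ + η)) K :=
      (hDi.integrableOn.add (integrableOn_const hKt)).const_mul ε
    have hint3 : ∫⁻ x, ENNReal.ofReal (h1 x) =
        ENNReal.ofReal (ε * ((∫ x in K, ‖fderiv ℝ w x‖) + η * volume.real K)) := by
      rw [← ofReal_integral_eq_lintegral_ofReal (hgi.integrable_indicator hKm)
        (Eventually.of_forall h10), integral_indicator hKm, integral_const_mul,
        integral_add hDi.integrableOn (integrableOn_const hKt), setIntegral_const, smul_eq_mul,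
        mul_comm η]
    have hD0 : 0 ≤ ∫ x in K, ‖fderiv ℝ w x‖ := integral_nonneg fun _ => norm_nonneg _
    rw [hint3, ← ENNReal.ofReal_mul (by positivity),
      ENNReal.ofReal_le_ofReal_iff (by positivity), mul_assoc] at hint2
    have hle : ∫ x in K, ‖fderiv ℝ w x‖ ≤ ∫ x, ‖fderiv ℝ w x‖ :=
      setIntegral_le_integral hDi (Eventually.of_forall fun _ => norm_nonneg _)
    linarith [le_of_mul_le_mul_left hint2 hε0]
  have hlim : Tendsto (fun η : ℝ => (∫ x, ‖fderiv ℝ w x‖) + η * volume.real K) (𝓝[>] 0)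
      (𝓝 ((∫ x, ‖fderiv ℝ w x‖) + 0 * volume.real K)) :=
    ((continuous_const.add (continuous_id.mul continuous_const)).tendsto 0).mono_left
      nhdsWithin_le_nhds
  rw [zero_mul, add_zero] at hlim
  exact ge_of_tendsto hlim (eventually_nhdsWithin_of_forall main)

theorem lapl_eq_sum_fderiv {n : ℕ} {φ : Euc n → ℝ} (hφ : ContDiff ℝ 2 φ) (x : Euc n) :
    lapl n φ x = ∑ i, fderiv ℝ (fun y => fderiv ℝ φ y (EuclideanSpace.single i 1)) x
      (EuclideanSpace.single i 1) := by
  rw [lapl]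
  refine Finset.sum_congr rfl fun i _ => ?_
  have hd : DifferentiableAt ℝ (fderiv ℝ φ) x :=
    ((hφ.fderiv_right (m := 1) (by norm_num)).differentiable one_ne_zero) x
  rw [iteratedFDeriv_two_apply, fderiv_clm_apply hd (differentiableAt_const _)]
  simp

theorem contDiff_fderiv_apply_const {n : ℕ} {φ : Euc n → ℝ} (hφ : ContDiff ℝ 2 φ) (v : Euc n) :
    ContDiff ℝ 1 fun y => fderiv ℝ φ y v :=
  (hφ.fderiv_right (m := 1) (by norm_num)).clm_apply contDiff_const

theorem continuous_lapl {n : ℕ} {φ : Euc n → ℝ} (hφ : ContDiff ℝ 2 φ) :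
    Continuous (lapl n φ) := by
  simp_rw [funext (lapl_eq_sum_fderiv hφ)]
  exact continuous_finsetSum _ fun i _ =>
    ((contDiff_fderiv_apply_const hφ _).continuous_fderiv one_ne_zero).clm_apply continuous_const

theorem hasCompactSupport_lapl {n : ℕ} {φ : Euc n → ℝ} (hc : HasCompactSupport φ) :
    HasCompactSupport (lapl n φ) := by
  refine hc.mono' fun x hx => ?_
  by_contra hxs
  refine hx ?_
  have h0 : iteratedFDeriv ℝ 2 φ x = 0 := by
    by_contra h
    exact hxs (support_iteratedFDeriv_subset (𝕜 := ℝ) 2 h)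
  simp [lapl, h0]

theorem integrable_lapl {n : ℕ} {φ : Euc n → ℝ} (hφ : ContDiff ℝ 2 φ) (hc : HasCompactSupport φ) :
    Integrable (lapl n φ) :=
  (continuous_lapl hφ).integrable_of_hasCompactSupport (hasCompactSupport_lapl hc)

/-- Green's identity on the whole space. -/
theorem integral_mul_lapl {n : ℕ} {φ w : Euc n → ℝ} (hφ : ContDiff ℝ 2 φ)
    (hc : HasCompactSupport φ) (hw : ContDiff ℝ 1 w) :
    ∫ x, w x * lapl n φ x = - ∫ x, ∑ i, fderiv ℝ w x (EuclideanSpace.single i 1) *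
      fderiv ℝ φ x (EuclideanSpace.single i 1) := by
  have hd1 := fun v => contDiff_fderiv_apply_const hφ v
  have hs1 : ∀ v, HasCompactSupport fun y => fderiv ℝ φ y v := fun v => hc.fderiv_apply ℝ v
  have hwc := hw.continuous
  have hwd : ∀ v, Continuous fun x => fderiv ℝ w x v := fun v =>
    (hw.continuous_fderiv one_ne_zero).clm_apply continuous_const
  have hi1 : ∀ v, Integrable fun x => fderiv ℝ w x v * fderiv ℝ φ x v := fun v =>
    ((hwd v).mul (hd1 v).continuous).integrable_of_hasCompactSupport (hs1 v).mul_left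
  have hi2 : ∀ v, Integrable fun x => w x * fderiv ℝ (fun y => fderiv ℝ φ y v) x v := fun v =>
    (hwc.mul (((hd1 v).continuous_fderiv one_ne_zero).clm_apply
      continuous_const)).integrable_of_hasCompactSupport ((hs1 v).fderiv_apply ℝ v).mul_left
  simp_rw [lapl_eq_sum_fderiv hφ, Finset.mul_sum]
  rw [integral_finsetSum _ fun i _ => hi2 _, integral_finsetSum _ fun i _ => hi1 _,
    ← Finset.sum_neg_distrib]
  refine Finset.sum_congr rfl fun i _ => ?_
  exact integral_mul_fderiv_eq_neg_fderiv_mul_of_integrable (hi1 _) (hi2 _)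
    ((hwc.mul (hd1 _).continuous).integrable_of_hasCompactSupport (hs1 _).mul_left)
    (fun x _ => hw.differentiable one_ne_zero x) (fun x _ => (hd1 _).differentiable one_ne_zero x)

theorem integral_lapl {n : ℕ} {φ : Euc n → ℝ} (hφ : ContDiff ℝ 2 φ) (hc : HasCompactSupport φ) :
    ∫ x, lapl n φ x = 0 := by
  simpa using integral_mul_lapl hφ hc (contDiff_const (c := (1 : ℝ)))

theorem norm_sq_le_sum_apply_single {n : ℕ} (L : Euc n →L[ℝ] ℝ) :
    ‖L‖ ^ 2 ≤ ∑ i, L (EuclideanSpace.single i 1) * L (EuclideanSpace.single i 1) := by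
  obtain ⟨v, rfl⟩ := (InnerProductSpace.toDual ℝ (Euc n)).surjective L
  rw [LinearIsometryEquiv.norm_map, EuclideanSpace.norm_sq_eq]
  refine Finset.sum_le_sum fun i _ => ?_
  simp [sq, EuclideanSpace.inner_single_right]

/-- A continuous cutoff of the interval `(a, b)` with integral close to `b - a`, together with
its primitive. -/
theorem exists_cutoff_primitive {a b η : ℝ} (ha : 0 ≤ a) (hη : 0 < η) (hab : a + η ≤ b - η) :
    ∃ (k g : ℝ → ℝ), Continuous k ∧ (∀ s, 0 ≤ k s) ∧ (∀ s, k s ≤ (Set.Ioo a b).indicator 1 s) ∧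
      (∀ s, HasDerivAt g (k s) s) ∧ g 0 = 0 ∧ (∀ s, 0 ≤ g s) ∧ (∀ s, g s ≤ g b) ∧
      (∀ s, b ≤ s → g s = g b) ∧ b - a - 2 * η ≤ g b := by
  set k : ℝ → ℝ := fun s => max 0 (min 1 (min ((s - a) / η) ((b - s) / η))) with hk
  have hkc : Continuous k := by fun_prop
  have hk0 : ∀ s, 0 ≤ k s := fun s => le_max_left _ _
  have hka : ∀ s, s ≤ a → k s = 0 := fun s hs => max_eq_left <|
    (min_le_right _ _).trans <| (min_le_left _ _).trans <|
      div_nonpos_of_nonpos_of_nonneg (by linarith) hη.le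
  have hkb : ∀ s, b ≤ s → k s = 0 := fun s hs => max_eq_left <|
    (min_le_right _ _).trans <| (min_le_right _ _).trans <|
      div_nonpos_of_nonpos_of_nonneg (by linarith) hη.le
  set g : ℝ → ℝ := fun s => ∫ r in (0 : ℝ)..s, k r with hg
  have hii : ∀ c d, IntervalIntegrable k volume c d := fun c d => hkc.intervalIntegrable c d
  have hgs : ∀ c d, g d - g c = ∫ r in c..d, k r := fun c d =>
    intervalIntegral.integral_interval_sub_left (hii _ _) (hii _ _)
  have hmono : Monotone g := fun c d hcd => by
    have := intervalIntegral.integral_nonneg (μ := volume) hcd fun r _ => hk0 r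
    linarith [hgs c d]
  have hg0 : g 0 = 0 := intervalIntegral.integral_same
  have hgb : ∀ s, b ≤ s → g s = g b := fun s hs => by
    have : ∫ r in b..s, k r = 0 := by
      rw [intervalIntegral.integral_congr (g := fun _ => 0), intervalIntegral.integral_zero]
      intro r hr
      rw [Set.uIcc_of_le hs] at hr
      exact hkb r hr.1
    linarith [hgs b s]
  refine ⟨k, g, hkc, hk0, fun s => ?_, fun s =>
    intervalIntegral.integral_hasDerivAt_right (hii 0 s)
      (hkc.stronglyMeasurableAtFilter _ _) hkc.continuousAt, hg0, fun s => ?_, fun s => ?_, hgb, ?_⟩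
  · by_cases hs : s ∈ Set.Ioo a b
    · rw [Set.indicator_of_mem hs]
      exact max_le zero_le_one (min_le_left _ _)
    · rw [Set.indicator_of_notMem hs]
      rw [Set.mem_Ioo, not_and_or, not_lt, not_lt] at hs
      exact hs.elim (fun h => (hka s h).le) fun h => (hkb s h).le
  · rcases le_total 0 s with hs | hs
    · exact hg0 ▸ hmono hs
    · have : ∫ r in s..0, k r = 0 := by
        rw [intervalIntegral.integral_congr (g := fun _ => 0), intervalIntegral.integral_zero]
        intro r hr
        rw [Set.uIcc_of_le hs] at hr
        exact hka r (hr.2.trans ha)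
      linarith [hgs s 0]
  · rcases le_total s b with hs | hs
    · exact hmono hs
    · exact (hgb s hs).le
  · calc b - a - 2 * η = ∫ r in (a + η)..(b - η), (1 : ℝ) := by simp; ring
      _ ≤ ∫ r in (a + η)..(b - η), k r := by
        refine intervalIntegral.integral_mono_on hab (by simp) (hii _ _) fun r hr => ?_
        refine le_max_of_le_right (le_min le_rfl (le_min ?_ ?_))
        · rw [le_div_iff₀ hη]; linarith [hr.1]
        · rw [le_div_iff₀ hη]; linarith [hr.2]
      _ = g (b - η) - g (a + η) := (hgs _ _).symm
      _ ≤ g b := by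
        have h1 := hmono (show b - η ≤ b by linarith)
        have h2 := hmono (show 0 ≤ a + η by linarith)
        linarith

/-- The differential inequality of Talenti type, integrated over an interval of levels. -/
theorem sq_mul_sub_le_mul_volume {n : ℕ} (hn : 0 < n) {φ : Euc n → ℝ} (hφ : ContDiff ℝ 2 φ)
    (hc : HasCompactSupport φ) {M : ℝ} (hM : 0 < M) (hfM : ∫ x, max (-lapl n φ x) 0 ≤ M)
    {a b m : ℝ} (ha : 0 ≤ a) (hab : a < b) (hm : 0 < m) (hmb : m ≤ volume.real {x | b ≤ φ x}) :
    (n * unitBallVol n ^ (1 / (n : ℝ)) * m ^ (1 - 1 / (n : ℝ))) ^ 2 * (b - a) ≤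
      M * volume.real {x | a < φ x ∧ φ x < b} := by
  set κ := n * unitBallVol n ^ (1 / (n : ℝ)) * m ^ (1 - 1 / (n : ℝ)) with hκ
  have hκ0 : 0 ≤ κ := by
    have := (unitBallVol_pos n).le
    positivity
  set E := {x | a < φ x ∧ φ x < b} with hE
  have hφc := hφ.continuous
  have hEm : MeasurableSet E := (measurableSet_lt measurable_const hφc.measurable).inter
    (measurableSet_lt hφc.measurable measurable_const)
  have hsub : ∀ {τ : ℝ}, 0 ≤ τ → {x | τ < φ x} ⊆ tsupport φ := fun hτ x hx =>
    subset_tsupport _ (Function.mem_support.2 (hτ.trans_lt hx).ne')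
  have hEt : volume E ≠ ∞ := ((measure_mono fun x hx => hsub ha hx.1).trans_lt
    hc.isCompact.measure_lt_top).ne
  have main : ∀ η : ℝ, 0 < η → a + η ≤ b - η →
      κ ^ 2 * (b - a - 2 * η) ≤ M * volume.real E := by
    intro η hη hη2
    obtain ⟨k, g, hkc, hk0, hk1, hgd, hg0, hgnn, hgle, hgb, hG⟩ :=
      exists_cutoff_primitive ha hη hη2
    have hderiv : deriv g = k := funext fun s => (hgd s).deriv
    have hg1 : ContDiff ℝ 1 g :=
      contDiff_one_iff_deriv.2 ⟨fun s => (hgd s).differentiableAt, hderiv ▸ hkc⟩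
    set w : Euc n → ℝ := fun x => g (φ x) with hw
    have hw1 : ContDiff ℝ 1 w := hg1.comp (hφ.of_le (by norm_num))
    have hwc : HasCompactSupport w := hc.comp_left hg0
    have hwd : ∀ x, fderiv ℝ w x = k (φ x) • fderiv ℝ φ x := fun x =>
      ((hgd (φ x)).comp_hasFDerivAt x (hφ.differentiable two_ne_zero x).hasFDerivAt).fderiv
    have hkz : k 0 = 0 := le_antisymm ((hk1 0).trans_eq
      (Set.indicator_of_notMem (fun h => ha.not_gt h.1) _)) (hk0 0)
    have hlow := mul_le_integral_norm_fderiv hn hw1 hwc (fun x => hgnn _) (G := g b) hm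
      (fun τ hτ hτb => hmb.trans <| measureReal_mono
        (fun x hx => by rw [Set.mem_ofPred_eq, hw]; dsimp only; rwa [hgb _ hx])
        ((measure_mono fun x hx => subset_tsupport w
          (Function.mem_support.2 (hτ.trans_lt hx).ne')).trans_lt hwc.isCompact.measure_lt_top).ne)
    have hDc : Continuous fun x => ‖fderiv ℝ φ x‖ := (hφ.continuous_fderiv two_ne_zero).norm
    have hkφs : HasCompactSupport fun x => k (φ x) := hc.comp_left hkz
    have hkφc : Continuous fun x => k (φ x) := hkc.comp hφc
    have hi0 : Integrable fun x => k (φ x) := hkφc.integrable_of_hasCompactSupport hkφs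
    have hi1 : Integrable fun x => k (φ x) * ‖fderiv ℝ φ x‖ :=
      (hkφc.mul hDc).integrable_of_hasCompactSupport hkφs.mul_right
    have hi2 : Integrable fun x => k (φ x) * ‖fderiv ℝ φ x‖ ^ 2 :=
      (hkφc.mul (hDc.pow 2)).integrable_of_hasCompactSupport hkφs.mul_right
    have hgreen := integral_mul_lapl hφ hc hw1
    have hdi : ∀ v, Continuous fun x => fderiv ℝ φ x v := fun v =>
      (hφ.continuous_fderiv two_ne_zero).clm_apply continuous_const
    have henergy : ∫ x, k (φ x) * ‖fderiv ℝ φ x‖ ^ 2 ≤ g b * M := by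
      calc ∫ x, k (φ x) * ‖fderiv ℝ φ x‖ ^ 2
          ≤ ∫ x, ∑ i, fderiv ℝ w x (EuclideanSpace.single i 1) *
              fderiv ℝ φ x (EuclideanSpace.single i 1) := by
            refine integral_mono hi2 ?_ fun x => ?_
            · refine integrable_finsetSum _ fun i _ => ?_
              simp_rw [hwd, smul_apply, smul_eq_mul]
              exact ((hkφc.mul (hdi _)).mul (hdi _)).integrable_of_hasCompactSupport
                hkφs.mul_right.mul_right
            · simp_rw [hwd, smul_apply, smul_eq_mul, mul_assoc, ← Finset.mul_sum]
              exact mul_le_mul_of_nonneg_left (norm_sq_le_sum_apply_single _) (hk0 _)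
        _ = ∫ x, w x * -lapl n φ x := by
            simp_rw [mul_neg, integral_neg, hgreen, neg_neg]
        _ ≤ ∫ x, g b * max (-lapl n φ x) 0 := by
            refine integral_mono ?_ ?_ fun x => ?_
            · exact (hw1.continuous.mul (continuous_lapl hφ).neg).integrable_of_hasCompactSupport
                hwc.mul_right
            · exact ((integrable_lapl hφ hc).neg.pos_part).const_mul _
            · exact (mul_le_mul_of_nonneg_left (le_max_left _ _) (hgnn _)).trans
                (mul_le_mul_of_nonneg_right (hgle _) (le_max_right _ _))
        _ ≤ g b * M := by
            rw [integral_const_mul]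
            exact mul_le_mul_of_nonneg_left hfM (hgnn b)
    have hkE : ∫ x, k (φ x) ≤ volume.real E := by
      rw [← integral_indicator_one hEm]
      refine integral_mono hi0 ((integrable_indicator_iff hEm).2 (integrableOn_const hEt)) fun x => ?_
      exact hk1 (φ x)
    have hLint : ∫ x, ‖fderiv ℝ w x‖ = ∫ x, k (φ x) * ‖fderiv ℝ φ x‖ := by
      refine integral_congr_ae (Eventually.of_forall fun x => ?_)
      dsimp only
      rw [hwd, norm_smul, Real.norm_of_nonneg (hk0 _)]
    have hamgm : 2 * κ * ∫ x, k (φ x) * ‖fderiv ℝ φ x‖ ≤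
        κ ^ 2 / M * (∫ x, k (φ x) * ‖fderiv ℝ φ x‖ ^ 2) + M * ∫ x, k (φ x) := by
      rw [← integral_const_mul, ← integral_const_mul, ← integral_const_mul,
        ← integral_add (hi2.const_mul _) (hi0.const_mul _)]
      refine integral_mono (hi1.const_mul _) ((hi2.const_mul _).add (hi0.const_mul _)) fun x => ?_
      dsimp only
      have h1 : 2 * κ * ‖fderiv ℝ φ x‖ ≤ κ ^ 2 / M * ‖fderiv ℝ φ x‖ ^ 2 + M := by
        rw [div_mul_eq_mul_div, ← sub_nonneg]
        have : κ ^ 2 * ‖fderiv ℝ φ x‖ ^ 2 / M + M - 2 * κ * ‖fderiv ℝ φ x‖ =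
          (κ * ‖fderiv ℝ φ x‖ - M) ^ 2 / M := by field_simp; ring
        rw [this]; positivity
      calc 2 * κ * (k (φ x) * ‖fderiv ℝ φ x‖) = k (φ x) * (2 * κ * ‖fderiv ℝ φ x‖) := by ring
        _ ≤ k (φ x) * (κ ^ 2 / M * ‖fderiv ℝ φ x‖ ^ 2 + M) :=
          mul_le_mul_of_nonneg_left h1 (hk0 _)
        _ = _ := by ring
    rw [hLint] at hlow
    have e1 : κ ^ 2 / M * (∫ x, k (φ x) * ‖fderiv ℝ φ x‖ ^ 2) ≤ κ ^ 2 * g b :=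
      calc _ ≤ κ ^ 2 / M * (g b * M) := by gcongr
        _ = _ := by field_simp
    have e2 : κ * (κ * g b) ≤ κ * ∫ x, k (φ x) * ‖fderiv ℝ φ x‖ := by gcongr
    have e3 : M * ∫ x, k (φ x) ≤ M * volume.real E := by gcongr
    have e4 : κ ^ 2 * (b - a - 2 * η) ≤ κ ^ 2 * g b := by gcongr
    nlinarith
  have hlim : Tendsto (fun η : ℝ => κ ^ 2 * (b - a - 2 * η)) (𝓝[>] 0)
      (𝓝 (κ ^ 2 * (b - a - 2 * 0))) :=
    ((by fun_prop : Continuous fun η : ℝ => κ ^ 2 * (b - a - 2 * η)).tendsto 0).mono_left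
      nhdsWithin_le_nhds
  rw [mul_zero, sub_zero] at hlim
  refine le_of_tendsto hlim ?_
  filter_upwards [Ioo_mem_nhdsGT (show (0 : ℝ) < (b - a) / 2 by linarith)] with η hη
  exact main η hη.1 (by linarith [hη.2])

/-- The constant in the isoperimetric inequality, squared. -/
def isoConst (n : ℕ) : ℝ := n ^ 2 * unitBallVol n ^ (2 / (n : ℝ))

theorem isoConst_pos {n : ℕ} (hn : 0 < n) : 0 < isoConst n := by
  have h := unitBallVol_pos n
  have hn' : (0 : ℝ) < n := by exact_mod_cast hn
  unfold isoConst
  positivity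

theorem sq_perimeter_eq {n : ℕ} {m : ℝ} (hm : 0 ≤ m) :
    (n * unitBallVol n ^ (1 / (n : ℝ)) * m ^ (1 - 1 / (n : ℝ))) ^ 2 =
      isoConst n * m ^ (2 - 2 / (n : ℝ)) := by
  rw [mul_pow, mul_pow, ← Real.rpow_mul_natCast (unitBallVol_pos n).le, ← Real.rpow_mul_natCast hm,
    isoConst]
  congr 3 <;> push_cast <;> ring

theorem isoConst_two_mul_NstarV (V t : ℝ) : isoConst 2 * NstarV 2 V t = Real.log (V / t) := by
  have h : isoConst 2 = 4 * Real.pi := by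
    rw [isoConst, unitBallVol_eq two_pos, omegaS]
    norm_num
  rw [h, NstarV, if_pos rfl]
  have := Real.pi_pos
  field_simp

theorem isoConst_mul_NstarV {n : ℕ} (hn : 3 ≤ n) (V t : ℝ) :
    isoConst n * NstarV n V t = (t ^ (-(((n : ℝ) - 2) / n)) - V ^ (-(((n : ℝ) - 2) / n))) /
      (((n : ℝ) - 2) / n) := by
  have hn' : (3 : ℝ) ≤ n := by exact_mod_cast hn
  have hn2 : (0 : ℝ) < n - 2 := by linarith
  have h := unitBallVol_pos n
  have hω : omegaS n = n * unitBallVol n := by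
    rw [unitBallVol_eq (by omega)]
    field_simp
  have hβ : unitBallVol n ^ (2 / (n : ℝ)) * unitBallVol n ^ (((n : ℝ) - 2) / n) =
      unitBallVol n := by
    rw [← Real.rpow_add h, ← add_div, add_sub_cancel, div_self (by positivity), Real.rpow_one]
  rw [NstarV, if_neg (by omega), cConst, ← unitBallVol_eq (by omega), hω, isoConst]
  generalize t ^ (-(((n : ℝ) - 2) / n)) - V ^ (-(((n : ℝ) - 2) / n)) = D
  calc (n : ℝ) ^ 2 * unitBallVol n ^ (2 / (n : ℝ)) * (1 / ((n - 2) * (n * unitBallVol n)) *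
        unitBallVol n ^ (((n : ℝ) - 2) / n) * D)
      = (unitBallVol n ^ (2 / (n : ℝ)) * unitBallVol n ^ (((n : ℝ) - 2) / n)) * (n ^ 2 *
        (1 / ((n - 2) * (n * unitBallVol n)) * D)) := by ring
    _ = _ := by rw [hβ]; field_simp

theorem NstarV_self (n : ℕ) {V : ℝ} (hV : 0 < V) : NstarV n V V = 0 := by
  simp [NstarV, hV.ne']

theorem sub_le_isoConst_mul {n : ℕ} (hn : 2 ≤ n) {V x y : ℝ} (hV : 0 < V) (hy : 0 < y)
    (hyx : y ≤ x) :
    x - y ≤ isoConst n * x ^ (2 - 2 / (n : ℝ)) * (NstarV n V y - NstarV n V x) := by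
  have hx : 0 < x := hy.trans_le hyx
  rw [mul_right_comm, mul_sub]
  have hlog : Real.log (y / x) ≤ y / x - 1 := Real.log_le_sub_one_of_pos (by positivity)
  rcases hn.eq_or_lt with rfl | hn
  · rw [isoConst_two_mul_NstarV, isoConst_two_mul_NstarV, Real.log_div hV.ne' hy.ne',
      Real.log_div hV.ne' hx.ne']
    rw [Real.log_div hy.ne' hx.ne'] at hlog
    norm_num
    have : x * (Real.log y - Real.log x) ≤ x * (y / x - 1) := by gcongr
    have h2 : x * (y / x - 1) = y - x := by field_simp
    rw [h2] at this
    linarith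
  · have hn' : (3 : ℝ) ≤ n := by exact_mod_cast hn
    rw [isoConst_mul_NstarV hn, isoConst_mul_NstarV hn]
    set a := ((n : ℝ) - 2) / n with ha
    have ha0 : 0 < a := div_pos (by linarith) (by linarith)
    have hp : 2 - 2 / (n : ℝ) = 1 + a := by rw [ha]; field_simp; ring
    rw [hp, Real.rpow_add hx, Real.rpow_one]
    have h1 : 1 - a * (y / x - 1) ≤ (y / x) ^ (-a) := by
      rw [Real.rpow_def_of_pos (by positivity)]
      refine le_trans ?_ (Real.add_one_le_exp _)
      nlinarith
    rw [Real.div_rpow hy.le hx.le, Real.rpow_neg hx.le, div_inv_eq_mul] at h1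
    rw [Real.rpow_neg hx.le]
    have hxa : 0 < x ^ a := by positivity
    have h2 : x * (1 - a * (y / x - 1)) ≤ x * (y ^ (-a) * x ^ a) := by gcongr
    have h3 : x * (1 - a * (y / x - 1)) = x + a * (x - y) := by field_simp; ring
    rw [h3] at h2
    have h4 : ((y ^ (-a) - V ^ (-a)) / a - ((x ^ a)⁻¹ - V ^ (-a)) / a) * (x * x ^ a) =
        (x * (y ^ (-a) * x ^ a) - x) / a := by
      field_simp; ring
    rw [h4, le_div_iff₀ ha0]
    linarith

theorem NstarV_le_NstarV {n : ℕ} (hn : 2 ≤ n) {V x y : ℝ} (hV : 0 < V) (hy : 0 < y)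
    (hyx : y ≤ x) : NstarV n V x ≤ NstarV n V y := by
  have h := sub_le_isoConst_mul hn hV hy hyx
  have hx : 0 < x := hy.trans_le hyx
  have hC := isoConst_pos (n := n) (by omega)
  have : 0 < isoConst n * x ^ (2 - 2 / (n : ℝ)) := by positivity
  by_contra hlt
  nlinarith

/-- Pointwise estimate of the distribution function by the Green function of a ball. -/
theorem le_mul_NstarV_of_superlevel {n : ℕ} (hn : 2 ≤ n) {φ : Euc n → ℝ} (hφ : ContDiff ℝ 2 φ)
    (hc : HasCompactSupport φ) {M : ℝ} (hM : 0 < M) (hfM : ∫ x, max (-lapl n φ x) 0 ≤ M)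
    {s : ℝ} (hs : 0 ≤ s) (hμs : 0 < volume.real {x | s < φ x}) :
    s ≤ M * NstarV n (volume.real {x | 0 < φ x}) (volume.real {x | s < φ x}) := by
  set μ : ℝ → ℝ := fun b => volume.real {x | b < φ x} with hμ
  have hφm := hφ.continuous.measurable
  have hfin : ∀ {b : ℝ}, 0 ≤ b → volume {x | b < φ x} ≠ ∞ := fun hb =>
    ((measure_mono fun x hx => subset_tsupport φ
      (Function.mem_support.2 (hb.trans_lt hx).ne')).trans_lt hc.isCompact.measure_lt_top).ne
  have hanti : ∀ {b c : ℝ}, 0 ≤ b → b ≤ c → μ c ≤ μ b := fun hb hbc =>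
    measureReal_mono (fun x hx => lt_of_le_of_lt hbc hx) (hfin hb)
  have hμpos : ∀ {b : ℝ}, 0 ≤ b → b ≤ s → 0 < μ b := fun hb hbs => hμs.trans_le (hanti hb hbs)
  have hV : 0 < μ 0 := hμpos le_rfl hs
  set Φ : ℝ → ℝ := fun b => NstarV n (μ 0) (μ b) with hΦ
  have hΦmono : ∀ {b c : ℝ}, 0 ≤ b → b ≤ c → c ≤ s → Φ b ≤ Φ c := fun hb hbc hcs =>
    NstarV_le_NstarV hn hV (hμpos (hb.trans hbc) hcs) (hanti hb hbc)
  have hC := isoConst_pos (n := n) (by omega)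
  have main : ∀ θ : ℝ, 0 < θ → θ < 1 → θ * s ≤ M * Φ s := by
    intro θ hθ0 hθ1
    set S := {b : ℝ | b ∈ Set.Icc 0 s ∧ θ * b ≤ M * Φ b} with hS
    have h0S : (0 : ℝ) ∈ S := ⟨⟨le_rfl, hs⟩, by simp [hΦ, NstarV_self n hV]⟩
    have hbdd : BddAbove S := ⟨s, fun b hb => hb.1.2⟩
    set c := sSup S with hc'
    have hc0 : 0 ≤ c := le_csSup hbdd h0S
    have hcs : c ≤ s := csSup_le ⟨0, h0S⟩ fun b hb => hb.1.2
    have hcΦ : θ * c ≤ M * Φ c := by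
      rw [← le_div_iff₀' hθ0]
      refine csSup_le ⟨0, h0S⟩ fun b hb => ?_
      rw [le_div_iff₀' hθ0]
      exact hb.2.trans (mul_le_mul_of_nonneg_left
        (hΦmono hb.1.1 (le_csSup hbdd hb) hcs) hM.le)
    rcases hcs.eq_or_lt with hcs' | hcs'
    · rwa [hcs'] at hcΦ
    exfalso
    set b : ℕ → ℝ := fun k => c + 1 / ((k : ℝ) + 1) with hb
    have hbt : Tendsto b atTop (𝓝 c) := by
      have := (tendsto_const_nhds (x := c)).add (tendsto_one_div_add_atTop_nhds_zero_nat (𝕜 := ℝ))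
      rwa [add_zero] at this
    have hbc : ∀ k, c < b k := fun k => by
      have : (0 : ℝ) < 1 / ((k : ℝ) + 1) := by positivity
      simp only [hb]; linarith
    have hν : Tendsto (fun k => volume.real {x | b k ≤ φ x}) atTop (𝓝 (μ c)) := by
      have hU : {x | c < φ x} = ⋃ k, {x | b k ≤ φ x} := by
        ext x
        simp only [Set.mem_iUnion, Set.mem_ofPred_eq]
        refine ⟨fun hx => ?_, fun ⟨k, hk⟩ => (hbc k).trans_le hk⟩
        exact ((hbt.eventually (gt_mem_nhds hx)).exists).imp fun k hk => le_of_lt hk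
      have hmono : Monotone fun k => {x | b k ≤ φ x} := fun i j hij x hx => by
        refine le_trans ?_ (show b i ≤ φ x from hx)
        simp only [hb]
        gcongr
      have := tendsto_measure_iUnion_atTop (μ := volume) hmono
      rw [← hU] at this
      exact (ENNReal.tendsto_toReal (hfin hc0)).comp this
    have hμc := hμpos hc0 hcs
    have hr : Tendsto (fun k => (volume.real {x | b k ≤ φ x} / μ c) ^ (2 - 2 / (n : ℝ))) atTop
        (𝓝 1) := by
      have h1 := hν.div_const (μ c)
      rw [div_self hμc.ne'] at h1
      simpa using h1.rpow_const (p := 2 - 2 / (n : ℝ)) (Or.inl one_ne_zero)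
    obtain ⟨k, hk1, hk2⟩ := ((hr.eventually (lt_mem_nhds hθ1)).and
      (hbt.eventually (gt_mem_nhds hcs'))).exists
    set ν := volume.real {x | b k ≤ φ x} with hνdef
    have hbk0 : 0 ≤ b k := hc0.trans (hbc k).le
    have hsub : {x | b k ≤ φ x} ⊆ {x | c < φ x} := fun x hx => (hbc k).trans_le hx
    have hμν : μ (b k) ≤ ν := measureReal_mono (fun x hx => le_of_lt (show b k < φ x from hx))
      ((measure_mono hsub).trans_lt (hfin hc0).lt_top).ne
    have hν0 : 0 < ν := (hμpos hbk0 hk2.le).trans_le hμν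
    have hνc : ν ≤ μ c := measureReal_mono hsub (hfin hc0)
    have h1 := sq_mul_sub_le_mul_volume (by omega) hφ hc hM hfM hc0 (hbc k) hν0 le_rfl
    have hdiff : volume.real {x | c < φ x ∧ φ x < b k} = μ c - ν := by
      have : {x | c < φ x ∧ φ x < b k} = {x | c < φ x} \ {x | b k ≤ φ x} := by
        ext x; simp
      rw [this, measureReal_sdiff hsub (measurableSet_le measurable_const hφm) (hfin hc0)]
    rw [sq_perimeter_eq hν0.le, hdiff] at h1
    have h2 := sub_le_isoConst_mul hn hV hν0 hνc
    have h3 : NstarV n (μ 0) ν ≤ Φ (b k) := NstarV_le_NstarV hn hV (hμpos hbk0 hk2.le) hμν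
    rw [Real.div_rpow hν0.le hμc.le, lt_div_iff₀ (by positivity)] at hk1
    have hP : 0 < isoConst n * μ c ^ (2 - 2 / (n : ℝ)) := by positivity
    have h4 : (isoConst n * μ c ^ (2 - 2 / (n : ℝ))) * (θ * (b k - c)) ≤
        (isoConst n * μ c ^ (2 - 2 / (n : ℝ))) * (M * (Φ (b k) - Φ c)) :=
      calc _ = isoConst n * (θ * μ c ^ (2 - 2 / (n : ℝ))) * (b k - c) := by ring
        _ ≤ isoConst n * ν ^ (2 - 2 / (n : ℝ)) * (b k - c) := by
          have := (hbc k).le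
          have : 0 ≤ b k - c := by linarith
          gcongr
        _ ≤ M * (μ c - ν) := h1
        _ ≤ M * (isoConst n * μ c ^ (2 - 2 / (n : ℝ)) * (Φ (b k) - Φ c)) := by
          refine mul_le_mul_of_nonneg_left (h2.trans ?_) hM.le
          gcongr
        _ = _ := by ring
    have h5 := le_of_mul_le_mul_left h4 hP
    have hbS : b k ∈ S := ⟨⟨hbk0, hk2.le⟩, by linarith⟩
    exact (hbc k).not_ge (le_csSup hbdd hbS)
  have hlim : Tendsto (fun θ : ℝ => θ * s) (𝓝[<] 1) (𝓝 (1 * s)) :=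
    ((continuous_id.mul continuous_const).tendsto 1).mono_left nhdsWithin_le_nhds
  rw [one_mul] at hlim
  refine le_of_tendsto hlim ?_
  filter_upwards [Ioo_mem_nhdsLT (zero_lt_one' ℝ)] with θ hθ
  exact main θ hθ.1 hθ.2

theorem NstarV_le_NstarV_left {n : ℕ} (hn : 2 ≤ n) {V W t : ℝ} (ht : 0 < t) (hV : 0 < V)
    (hVW : V ≤ W) : NstarV n V t ≤ NstarV n W t := by
  have hC := isoConst_pos (n := n) (by omega)
  refine le_of_mul_le_mul_left ?_ hC
  rcases hn.eq_or_lt with rfl | hn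
  · rw [isoConst_two_mul_NstarV, isoConst_two_mul_NstarV]
    exact Real.log_le_log (by positivity) (by gcongr)
  · rw [isoConst_mul_NstarV hn, isoConst_mul_NstarV hn]
    have hn' : (3 : ℝ) ≤ n := by exact_mod_cast hn
    have ha0 : 0 < ((n : ℝ) - 2) / n := div_pos (by linarith) (by linarith)
    have := Real.rpow_le_rpow_of_nonpos hV hVW (neg_nonpos.2 ha0.le)
    gcongr

theorem NstarV_nonneg {n : ℕ} (hn : 2 ≤ n) {V t : ℝ} (ht : 0 < t) (htV : t ≤ V) :
    0 ≤ NstarV n V t :=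
  (NstarV_self n (ht.trans_le htV)).symm.trans_le (NstarV_le_NstarV hn (ht.trans_le htV) ht htV)

theorem convexOn_rpow_neg {a : ℝ} (ha : 0 ≤ a) :
    ConvexOn ℝ (Set.Ioi 0) fun x : ℝ => x ^ (-a) := by
  refine ⟨convex_Ioi 0, fun x hx y hy p q hp hq hpq => ?_⟩
  have hxy : 0 < p • x + q • y := (convex_Ioi (0 : ℝ)) hx hy hp hq hpq
  have h := strictConcaveOn_log_Ioi.concaveOn.2 hx hy hp hq hpq
  have he := convexOn_exp.2 (Set.mem_univ (Real.log x * -a)) (Set.mem_univ (Real.log y * -a))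
    hp hq hpq
  dsimp only
  rw [Real.rpow_def_of_pos hxy, Real.rpow_def_of_pos hx, Real.rpow_def_of_pos hy]
  refine le_trans (Real.exp_le_exp.2 ?_) he
  simp only [smul_eq_mul] at h ⊢
  nlinarith

theorem rpow_neg_sub_le_of_add {a σ t₁ t₂ V₁ V₂ V : ℝ} (ha : 0 < a) (hσ : 0 ≤ σ) (ht₁ : 0 < t₁)
    (ht₂ : 0 < t₂) (hV₁ : 0 < V₁) (hV₂ : 0 < V₂) (hV : V₁ + V₂ ≤ V)
    (h₁ : σ ≤ t₁ ^ (-a) - V₁ ^ (-a)) (h₂ : σ ≤ t₂ ^ (-a) - V₂ ^ (-a)) :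
    σ ≤ 2 ^ a * ((t₁ + t₂) ^ (-a) - V ^ (-a)) := by
  set t := t₁ + t₂ with ht
  have ht0 : 0 < t := by positivity
  have hV0 : 0 < V := by linarith
  have hconv := convexOn_rpow_neg ha.le
  have hw : t₁ / t + t₂ / t = 1 := by rw [← add_div, div_self ht0.ne']
  have key : ∀ {s U : ℝ}, 0 < s → 0 < U → σ ≤ s ^ (-a) - U ^ (-a) →
      (U / s) ^ (-a) ≤ 1 - σ * s ^ a := by
    intro s U hs hU h
    rw [Real.div_rpow hU.le hs.le, Real.rpow_neg hs.le, div_inv_eq_mul]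
    rw [Real.rpow_neg hs.le] at h
    have hsa : 0 < s ^ a := by positivity
    have : U ^ (-a) * s ^ a ≤ ((s ^ a)⁻¹ - σ) * s ^ a := by gcongr; linarith
    rwa [sub_mul, inv_mul_cancel₀ hsa.ne'] at this
  have c1 : (V / t) ^ (-a) ≤ t₁ / t * (V₁ / t₁) ^ (-a) + t₂ / t * (V₂ / t₂) ^ (-a) := by
    have h := hconv.2 (Set.mem_Ioi.2 (div_pos hV₁ ht₁)) (Set.mem_Ioi.2 (div_pos hV₂ ht₂))
      (div_pos ht₁ ht0).le (div_pos ht₂ ht0).le hw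
    refine le_trans (Real.rpow_le_rpow_of_nonpos ?_ ?_ (neg_nonpos.2 ha.le)) h
    · simp only [smul_eq_mul]; positivity
    · simp only [smul_eq_mul]
      rw [div_mul_div_comm, mul_comm t₁, mul_div_mul_right _ _ ht₁.ne', div_mul_div_comm, mul_comm t₂,
        mul_div_mul_right _ _ ht₂.ne', ← add_div]
      gcongr
  have c2 : t * (t / 2) ^ a ≤ t₁ * t₁ ^ a + t₂ * t₂ ^ a := by
    have h := (convexOn_rpow (p := 1 + a) (by linarith)).2 ht₁.le ht₂.le one_half_pos.le one_half_pos.le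
      (add_halves (1 : ℝ))
    simp only [smul_eq_mul] at h
    rw [← mul_add, ← ht, one_div_mul_eq_div, Real.rpow_add (by positivity), Real.rpow_add ht₁,
      Real.rpow_add ht₂, Real.rpow_one, Real.rpow_one, Real.rpow_one] at h
    linarith
  have c3 : (V / t) ^ (-a) ≤ 1 - σ * (t / 2) ^ a := by
    have e1 := key ht₁ hV₁ h₁
    have e2 := key ht₂ hV₂ h₂
    calc (V / t) ^ (-a) ≤ t₁ / t * (V₁ / t₁) ^ (-a) + t₂ / t * (V₂ / t₂) ^ (-a) := c1
      _ ≤ t₁ / t * (1 - σ * t₁ ^ a) + t₂ / t * (1 - σ * t₂ ^ a) := by gcongr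
      _ = (t₁ / t + t₂ / t) - σ * ((t₁ * t₁ ^ a + t₂ * t₂ ^ a) / t) := by ring
      _ ≤ 1 - σ * ((t * (t / 2) ^ a) / t) := by rw [hw]; gcongr
      _ = _ := by rw [mul_div_cancel_left₀ _ ht0.ne']
  rw [Real.div_rpow hV0.le ht0.le, Real.div_rpow ht0.le two_pos.le, Real.rpow_neg ht0.le,
    div_inv_eq_mul] at c3
  rw [Real.rpow_neg ht0.le]
  have hta : 0 < t ^ a := by positivity
  have h2a : (0 : ℝ) < 2 ^ a := by positivity
  have c4 : σ / 2 ^ a * t ^ a ≤ ((t ^ a)⁻¹ - V ^ (-a)) * t ^ a := by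
    rw [sub_mul, inv_mul_cancel₀ hta.ne', div_mul_eq_mul_div, mul_div_assoc]
    linarith
  have c5 := le_of_mul_le_mul_right c4 hta
  rwa [div_le_iff₀' h2a] at c5

theorem le_mul_NstarV_add {n : ℕ} (hn : 2 ≤ n) {s M t₁ t₂ V₁ V₂ V : ℝ} (hs : 0 ≤ s) (hM : 0 < M)
    (ht₁ : 0 < t₁) (ht₂ : 0 < t₂) (hV₁ : 0 < V₁) (hV₂ : 0 < V₂) (hV : V₁ + V₂ ≤ V)
    (h₁ : s ≤ M * NstarV n V₁ t₁) (h₂ : s ≤ M * NstarV n V₂ t₂) :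
    s ≤ 2 ^ (1 - 2 / (n : ℝ)) * M * NstarV n V (t₁ + t₂) := by
  have hC := isoConst_pos (n := n) (by omega)
  have hdiv : ∀ {x : ℝ}, s ≤ M * x → isoConst n * s / M ≤ isoConst n * x := fun h => by
    rw [div_le_iff₀ hM, mul_assoc, mul_comm _ M]; gcongr
  have h₁ := hdiv h₁
  have h₂ := hdiv h₂
  have hσ : 0 ≤ isoConst n * s / M := by positivity
  suffices h : isoConst n * s / M ≤ 2 ^ (1 - 2 / (n : ℝ)) * (isoConst n * NstarV n V (t₁ + t₂)) by
    rw [div_le_iff₀ hM] at h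
    refine le_of_mul_le_mul_left (h.trans_eq ?_) hC
    ring
  rcases hn.eq_or_lt with rfl | hn
  · rw [isoConst_two_mul_NstarV] at h₁ h₂ ⊢
    have hx := fun {t V : ℝ} (ht : 0 < t) (hV : 0 < V) (h : isoConst 2 * s / M ≤ Real.log (V / t)) =>
      (le_div_iff₀ ht).1 ((Real.le_log_iff_exp_le (div_pos hV ht)).1 h)
    have e1 := hx ht₁ hV₁ h₁
    have e2 := hx ht₂ hV₂ h₂
    norm_num
    rw [Real.le_log_iff_exp_le (div_pos (by linarith) (by linarith)), le_div_iff₀ (by linarith)]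
    linarith
  · rw [isoConst_mul_NstarV hn] at h₁ h₂ ⊢
    have hn' : (3 : ℝ) ≤ n := by exact_mod_cast hn
    have ha : 1 - 2 / (n : ℝ) = ((n : ℝ) - 2) / n := by field_simp
    rw [ha]
    set a := ((n : ℝ) - 2) / n
    have ha0 : 0 < a := div_pos (by linarith) (by linarith)
    rw [le_div_iff₀ ha0] at h₁ h₂
    rw [← mul_div_assoc, le_div_iff₀ ha0]
    exact rpow_neg_sub_le_of_add ha0 (by positivity) ht₁ ht₂ hV₁ hV₂ hV h₁ h₂

theorem lapl_neg {n : ℕ} (φ : Euc n → ℝ) (x : Euc n) :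
    lapl n (fun y => -φ y) x = -lapl n φ x := by
  simp only [lapl, ← Finset.sum_neg_distrib]
  refine Finset.sum_congr rfl fun i _ => ?_
  rw [show (fun y => -φ y) = -φ from rfl, iteratedFDeriv_neg]
  rfl

/-- The sharp estimate for test functions. -/
theorem IsTestFun.le_mul_NstarV {n : ℕ} (hn : 2 ≤ n) {Ω : Set (Euc n)} (hΩ : volume Ω ≠ ∞)
    {φ : Euc n → ℝ} (hφ : IsTestFun n Ω φ) {M : ℝ} (hM : 0 < M)
    (hfM : ∫ x, |lapl n φ x| ≤ 2 * M) {s : ℝ} (hs : 0 ≤ s)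
    (hμs : 0 < volume.real {x | s < |φ x|}) :
    s ≤ 2 ^ (1 - 2 / (n : ℝ)) * M * NstarV n (volume.real Ω) (volume.real {x | s < |φ x|}) := by
  obtain ⟨hφs, hc, hsub⟩ := hφ
  have h2 : ContDiff ℝ 2 φ := hφs.of_le (WithTop.coe_le_coe.2 le_top)
  have hφm := hφs.continuous.measurable
  have hli := integrable_lapl h2 hc
  have hpart : ∀ ε : ℝ, ε = 1 ∨ ε = -1 → ∫ x, max (ε * lapl n φ x) 0 ≤ M := by
    intro ε hε
    have : ∀ x, max (ε * lapl n φ x) 0 = (|lapl n φ x| + ε * lapl n φ x) / 2 := fun x => by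
      have habs : |lapl n φ x| = |ε * lapl n φ x| := by
        rcases hε with rfl | rfl <;> simp
      rw [habs]
      rcases le_total 0 (ε * lapl n φ x) with h | h
      · rw [max_eq_left h, abs_of_nonneg h]; ring
      · rw [max_eq_right h, abs_of_nonpos h]; ring
    simp_rw [this]
    rw [integral_div, integral_add hli.abs (hli.const_mul _), integral_const_mul,
      integral_lapl h2 hc]
    linarith
  have hin : ∀ {E : Set (Euc n)}, (∀ x ∈ E, φ x ≠ 0) → E ⊆ Ω := fun h x hx =>
    hsub (subset_tsupport _ (h x hx))
  have hP : ∀ {r : ℝ}, 0 ≤ r → {x | r < φ x} ⊆ Ω := fun hr =>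
    hin fun x hx => (hr.trans_lt hx).ne'
  have hN : ∀ {r : ℝ}, 0 ≤ r → {x | r < -φ x} ⊆ Ω := fun hr =>
    hin fun x hx => neg_ne_zero.1 (hr.trans_lt hx).ne'
  have hfin : ∀ {E : Set (Euc n)}, E ⊆ Ω → volume E ≠ ∞ := fun h =>
    ((measure_mono h).trans_lt hΩ.lt_top).ne
  have hmN : ∀ r : ℝ, MeasurableSet {x | r < -φ x} := fun r =>
    measurableSet_lt measurable_const hφm.neg
  have hdisj : ∀ {r : ℝ}, 0 ≤ r → Disjoint {x | r < φ x} {x | r < -φ x} := fun {r} hr => by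
    refine Set.disjoint_left.2 fun x hx hx' => ?_
    have h1 : r < φ x := hx
    have h2 : r < -φ x := hx'
    linarith
  have hsum : ∀ {r : ℝ}, 0 ≤ r → volume.real {x | r < φ x} + volume.real {x | r < -φ x} =
      volume.real {x | r < |φ x|} := fun {r} hr => by
    rw [← measureReal_union (hdisj hr) (hmN r) (hfin (hP hr)) (hfin (hN hr))]
    congr 1
    ext x
    simp [lt_abs]
  set t₁ := volume.real {x | s < φ x} with ht₁
  set t₂ := volume.real {x | s < -φ x} with ht₂
  set V₁ := volume.real {x | 0 < φ x} with hV₁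
  set V₂ := volume.real {x | 0 < -φ x} with hV₂
  have htV₁ : t₁ ≤ V₁ := measureReal_mono (fun x hx => hs.trans_lt hx) (hfin (hP le_rfl))
  have htV₂ : t₂ ≤ V₂ := measureReal_mono (fun x hx => hs.trans_lt hx) (hfin (hN le_rfl))
  have hVV : V₁ + V₂ ≤ volume.real Ω := by
    rw [hsum le_rfl]
    exact measureReal_mono (hin fun x hx => abs_pos.1 hx) hΩ
  have hb₁ : 0 < t₁ → s ≤ M * NstarV n V₁ t₁ := fun h =>
    le_mul_NstarV_of_superlevel hn h2 hc hM (by simpa using hpart (-1) (Or.inr rfl)) hs h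
  have hb₂ : 0 < t₂ → s ≤ M * NstarV n V₂ t₂ := fun h =>
    le_mul_NstarV_of_superlevel hn h2.neg hc.neg hM
      (by simpa [lapl_neg] using hpart 1 (Or.inl rfl)) hs h
  have hone : (1 : ℝ) ≤ 2 ^ (1 - 2 / (n : ℝ)) := by
    have hn' : (2 : ℝ) ≤ n := by exact_mod_cast hn
    exact Real.one_le_rpow one_le_two (sub_nonneg.2 ((div_le_one (by linarith)).2 hn'))
  have hsingle : ∀ {t U : ℝ}, 0 < t → t ≤ U → U ≤ volume.real Ω → s ≤ M * NstarV n U t →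
      s ≤ 2 ^ (1 - 2 / (n : ℝ)) * M * NstarV n (volume.real Ω) t := fun {t U} ht htU hU h =>
    calc s ≤ M * NstarV n U t := h
      _ ≤ M * NstarV n (volume.real Ω) t := by
        gcongr; exact NstarV_le_NstarV_left hn ht (ht.trans_le htU) hU
      _ ≤ _ := by
        have := NstarV_nonneg hn ht (htU.trans hU)
        rw [mul_assoc]
        exact le_mul_of_one_le_left (by positivity) hone
  have ht₁0 : 0 ≤ t₁ := measureReal_nonneg
  have ht₂0 : 0 ≤ t₂ := measureReal_nonneg
  rw [← hsum hs, ← ht₁, ← ht₂] at hμs ⊢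
  rcases ht₁0.eq_or_lt with h1 | h1
  · rw [← h1, zero_add] at hμs ⊢
    exact hsingle hμs htV₂ (by linarith) (hb₂ hμs)
  · rcases ht₂0.eq_or_lt with h2 | h2
    · rw [← h2, add_zero] at hμs ⊢
      exact hsingle h1 htV₁ (by linarith) (hb₁ h1)
    · exact le_mul_NstarV_add hn hs hM h1 h2 (h1.trans_le htV₁) (h2.trans_le htV₂) hVV
        (hb₁ h1) (hb₂ h2)

theorem IsTestFun.setIntegral_abs_lapl {n : ℕ} {Ω : Set (Euc n)} {φ : Euc n → ℝ}
    (hφ : IsTestFun n Ω φ) : ∫ x in Ω, |lapl n φ x| = ∫ x, |lapl n φ x| := by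
  refine setIntegral_eq_integral_of_forall_compl_eq_zero fun x hx => ?_
  have h0 : iteratedFDeriv ℝ 2 φ x = 0 := by
    by_contra h
    exact hx (hφ.2.2 (support_iteratedFDeriv_subset (𝕜 := ℝ) 2 h))
  simp [lapl, h0]

theorem IsTestFun.integrable_lapl {n : ℕ} {Ω : Set (Euc n)} {φ : Euc n → ℝ}
    (hφ : IsTestFun n Ω φ) : Integrable (lapl n φ) :=
  _root_.integrable_lapl (hφ.1.of_le (WithTop.coe_le_coe.2 le_top)) hφ.2.1

theorem IsTestFun.integrable {n : ℕ} {Ω : Set (Euc n)} {φ : Euc n → ℝ}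
    (hφ : IsTestFun n Ω φ) : Integrable φ :=
  hφ.1.continuous.integrable_of_hasCompactSupport hφ.2.1

theorem L1norm_nonneg {n : ℕ} (Ω : Set (Euc n)) (f : Euc n → ℝ) : 0 ≤ L1norm n Ω f :=
  integral_nonneg fun _ => abs_nonneg _

/-- The sharp estimate for functions in the closure of the test functions. -/
theorem MemW21Delta0.decRearr_le {n : ℕ} (hn : 2 ≤ n) {Ω : Set (Euc n)} (hΩm : MeasurableSet Ω)
    (hΩ : volume Ω ≠ ∞) {u f : Euc n → ℝ} (h : MemW21Delta0 n Ω u f) {t : ℝ} (ht : 0 < t)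
    (htV : t ≤ volume.real Ω) :
    decRearr n Ω u t ≤ 2 ^ (-(2 / (n : ℝ))) * (NstarV n (volume.real Ω) t * L1norm n Ω f) := by
  obtain ⟨hu, hf, φ, hφ, hφu, hφf⟩ := h
  set N := NstarV n (volume.real Ω) t with hN
  set L := L1norm n Ω f with hL
  have hL0 : 0 ≤ L := L1norm_nonneg Ω f
  have hN0 : 0 ≤ N := NstarV_nonneg hn ht htV
  by_contra! hlt
  obtain ⟨s', hs'1, hs'2⟩ := exists_between hlt
  obtain ⟨s, hs1, hs2⟩ := exists_between hs'2
  have hs'0 : 0 ≤ s' := le_trans (by positivity) hs'1.le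
  have hT : t < volume.real {x ∈ Ω | s < |u x|} := by
    by_contra! hle
    refine hs2.not_ge (csInf_le ⟨0, fun r hr => hr.1⟩ ⟨hs'0.trans hs1.le, ?_⟩)
    rw [← ofReal_measureReal ((measure_mono (Set.sep_subset _ _)).trans_lt hΩ.lt_top).ne]
    exact ENNReal.ofReal_le_ofReal hle
  set T := volume.real {x ∈ Ω | s < |u x|} with hTdef
  have hpow : (2 : ℝ) ^ (1 - 2 / (n : ℝ)) = 2 * 2 ^ (-(2 / (n : ℝ))) := by
    rw [sub_eq_add_neg, Real.rpow_add two_pos, Real.rpow_one]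
  have main : ∀ ε : ℝ, 0 < ε → s' ≤ 2 ^ (1 - 2 / (n : ℝ)) * (L / 2 + ε) * N := by
    intro ε hε
    have hδ : 0 < (T - t) * (s - s') := mul_pos (sub_pos.2 hT) (sub_pos.2 hs1)
    obtain ⟨k, hk1, hk2⟩ := ((hφu.eventually (gt_mem_nhds hδ)).and
      (hφf.eventually (gt_mem_nhds (show 0 < 2 * ε by positivity)))).exists
    have hMk : ∫ x, |lapl n (φ k) x| ≤ 2 * (L / 2 + ε) := by
      rw [← (hφ k).setIntegral_abs_lapl]
      have hi := (hφ k).integrable_lapl.integrableOn (s := Ω)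
      calc ∫ x in Ω, |lapl n (φ k) x| ≤ ∫ x in Ω, (|lapl n (φ k) x - f x| + |f x|) := by
            refine integral_mono hi.abs ((hi.sub hf).abs.add hf.abs) fun x => ?_
            have := abs_add_le (lapl n (φ k) x - f x) (f x)
            rwa [sub_add_cancel] at this
        _ = (∫ x in Ω, |lapl n (φ k) x - f x|) + L := integral_add (hi.sub hf).abs hf.abs
        _ ≤ _ := by linarith
    set D := {x ∈ Ω | s - s' ≤ |φ k x - u x|} with hD
    have hDv : (s - s') * volume.real D < (s - s') * (T - t) := by
      have := mul_meas_ge_le_integral_of_nonneg (μ := volume.restrict Ω)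
        (f := fun x => |φ k x - u x|) (Eventually.of_forall fun _ => abs_nonneg _)
        (((hφ k).integrable.integrableOn (s := Ω)).sub hu).abs (s - s')
      rw [measureReal_restrict_apply' hΩm, Set.inter_comm] at this
      exact this.trans_lt (hk1.trans_eq (mul_comm _ _))
    have hDv' := lt_of_mul_lt_mul_left hDv (sub_pos.2 hs1).le
    set P := {x | s' < |φ k x|} with hP
    have hPΩ : P ⊆ Ω := fun x hx => (hφ k).2.2 (subset_tsupport _
      (abs_pos.1 (hs'0.trans_lt hx)))
    have hPfin : volume P ≠ ∞ := ((measure_mono hPΩ).trans_lt hΩ.lt_top).ne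
    have hcover : {x ∈ Ω | s < |u x|} ⊆ P ∪ D := fun x hx => by
      by_cases hxP : s' < |φ k x|
      · exact Or.inl hxP
      · refine Or.inr ⟨hx.1, ?_⟩
        have h1 : s < |u x| := hx.2
        have h2 := abs_sub_abs_le_abs_sub (u x) (φ k x)
        rw [abs_sub_comm] at h2
        linarith
    have hle : T ≤ volume.real P + volume.real D :=
      (measureReal_mono hcover (measure_union_ne_top hPfin
        ((measure_mono (Set.sep_subset _ _)).trans_lt hΩ.lt_top).ne)).trans
        (measureReal_union_le _ _)
    have htP : t ≤ volume.real P := by linarith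
    calc s' ≤ 2 ^ (1 - 2 / (n : ℝ)) * (L / 2 + ε) * NstarV n (volume.real Ω) (volume.real P) :=
          (hφ k).le_mul_NstarV hn hΩ (by positivity) hMk hs'0 (ht.trans_le htP)
      _ ≤ _ := by
        gcongr
        exact NstarV_le_NstarV hn (ht.trans_le htV) ht htP
  have hlim : Tendsto (fun ε : ℝ => 2 ^ (1 - 2 / (n : ℝ)) * (L / 2 + ε) * N) (𝓝[>] 0)
      (𝓝 (2 ^ (1 - 2 / (n : ℝ)) * (L / 2 + 0) * N)) :=
    ((by fun_prop : Continuous fun ε : ℝ => 2 ^ (1 - 2 / (n : ℝ)) * (L / 2 + ε) * N).tendsto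
      0).mono_left nhdsWithin_le_nhds
  have := ge_of_tendsto hlim (eventually_nhdsWithin_of_forall main)
  rw [hpow] at this
  linarith

theorem MemW21Delta0.div_le {n : ℕ} (hn : 2 ≤ n) {Ω : Set (Euc n)} (hΩm : MeasurableSet Ω)
    (hΩ : volume Ω ≠ ∞) {u f : Euc n → ℝ} (h : MemW21Delta0 n Ω u f) {t : ℝ} (ht : 0 < t)
    (htV : t ≤ volume.real Ω) :
    decRearr n Ω u t / (NstarV n (volume.real Ω) t * L1norm n Ω f) ≤ 2 ^ (-(2 / (n : ℝ))) :=
  div_le_of_le_mul₀ (mul_nonneg (NstarV_nonneg hn ht htV) (L1norm_nonneg Ω f)) (by positivity)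
    (h.decRearr_le hn hΩm hΩ ht htV)

/-- A smooth nonincreasing function equal to `1` on `(-∞, 1]` and to `0` on `[2, ∞)`. -/
def smoothCutoff (x : ℝ) : ℝ := Real.smoothTransition (2 - x)

theorem smoothCutoff_contDiff : ContDiff ℝ (⊤ : ℕ∞) smoothCutoff :=
  Real.smoothTransition.contDiff.comp (contDiff_const.sub contDiff_id)

theorem smoothCutoff_antitone : Antitone smoothCutoff := fun _ _ h =>
  Real.smoothTransition.monotone (sub_le_sub_left h 2)

theorem smoothCutoff_of_le {x : ℝ} (hx : x ≤ 1) : smoothCutoff x = 1 :=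
  Real.smoothTransition.one_of_one_le (by linarith)

theorem smoothCutoff_of_ge {x : ℝ} (hx : 2 ≤ x) : smoothCutoff x = 0 :=
  Real.smoothTransition.zero_of_nonpos (by linarith)

theorem smoothCutoff_nonneg (x : ℝ) : 0 ≤ smoothCutoff x := Real.smoothTransition.nonneg _

theorem smoothCutoff_le_one (x : ℝ) : smoothCutoff x ≤ 1 := Real.smoothTransition.le_one _

theorem hasDerivAt_smoothCutoff (x : ℝ) : HasDerivAt smoothCutoff (deriv smoothCutoff x) x :=
  (smoothCutoff_contDiff.differentiable (by simp) x).hasDerivAt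

theorem deriv_smoothCutoff_continuous : Continuous (deriv smoothCutoff) :=
  smoothCutoff_contDiff.continuous_deriv (by simp)

theorem deriv_smoothCutoff_nonpos (x : ℝ) : deriv smoothCutoff x ≤ 0 :=
  smoothCutoff_antitone.deriv_nonpos

theorem deriv_smoothCutoff_of_lt {x : ℝ} (hx : x < 1) : deriv smoothCutoff x = 0 := by
  have : smoothCutoff =ᶠ[𝓝 x] fun _ => 1 := by
    filter_upwards [gt_mem_nhds hx] with y hy using smoothCutoff_of_le (le_of_lt hy)
  rw [this.deriv_eq, deriv_const]

theorem deriv_smoothCutoff_of_gt {x : ℝ} (hx : 2 < x) : deriv smoothCutoff x = 0 := by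
  have : smoothCutoff =ᶠ[𝓝 x] fun _ => 0 := by
    filter_upwards [lt_mem_nhds hx] with y hy using smoothCutoff_of_ge (le_of_lt hy)
  rw [this.deriv_eq, deriv_const]

/-- A nonnegative radial density of total mass one concentrated on `r ≤ ‖x‖² ≤ 2 r`. -/
def radialSource (n : ℕ) (r : ℝ) (x : Euc n) : ℝ :=
  2 / (n * unitBallVol n) * (-deriv smoothCutoff (‖x‖ ^ 2 / r) / r) *
    (‖x‖ ^ 2) ^ (1 - (n : ℝ) / 2)

theorem radialSource_nonneg (n : ℕ) {r : ℝ} (hr : 0 < r) (x : Euc n) : 0 ≤ radialSource n r x := by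
  have h1 := unitBallVol_pos n
  have h2 := neg_nonneg.2 (deriv_smoothCutoff_nonpos (‖x‖ ^ 2 / r))
  unfold radialSource
  positivity

theorem radialSource_of_lt (n : ℕ) {r : ℝ} (hr : 0 < r) {x : Euc n} (hx : ‖x‖ ^ 2 < r) :
    radialSource n r x = 0 := by
  simp [radialSource, deriv_smoothCutoff_of_lt ((div_lt_one hr).2 hx)]

theorem radialSource_of_gt (n : ℕ) {r : ℝ} (hr : 0 < r) {x : Euc n} (hx : 2 * r < ‖x‖ ^ 2) :
    radialSource n r x = 0 := by
  simp [radialSource, deriv_smoothCutoff_of_gt ((lt_div_iff₀ hr).2 hx)]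

theorem radialSource_continuous (n : ℕ) {r : ℝ} (hr : 0 < r) : Continuous (radialSource n r) := by
  rw [continuous_iff_continuousAt]
  intro x
  rcases lt_or_ge (‖x‖ ^ 2) r with hx | hx
  · have : radialSource n r =ᶠ[𝓝 x] fun _ => 0 := by
      filter_upwards [(continuous_norm.pow 2).continuousAt.eventually (gt_mem_nhds hx)] with y hy
      exact radialSource_of_lt n hr hy
    exact continuousAt_const.congr this.symm
  · have h1 : Continuous fun y : Euc n => deriv smoothCutoff (‖y‖ ^ 2 / r) :=
      deriv_smoothCutoff_continuous.comp (by fun_prop)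
    have h2 : Continuous fun y : Euc n => ‖y‖ ^ 2 := by fun_prop
    exact (continuousAt_const.mul (h1.continuousAt.neg.div_const r)).mul
      (h2.continuousAt.rpow_const (Or.inl (hr.trans_le hx).ne'))

theorem radialSource_hasCompactSupport (n : ℕ) {r : ℝ} (hr : 0 < r) :
    HasCompactSupport (radialSource n r) := by
  refine HasCompactSupport.intro (isCompact_closedBall (0 : Euc n) (√(2 * r))) fun x hx => ?_
  refine radialSource_of_gt n hr ?_
  rw [mem_closedBall_zero_iff, not_le] at hx
  exact (Real.sqrt_lt' ((Real.sqrt_nonneg _).trans_lt hx)).1 hx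

theorem radialSource_integrable (n : ℕ) {r : ℝ} (hr : 0 < r) : Integrable (radialSource n r) :=
  (radialSource_continuous n hr).integrable_of_hasCompactSupport
    (radialSource_hasCompactSupport n hr)

theorem integral_radialSource {n : ℕ} (hn : 0 < n) {r : ℝ} (hr : 0 < r) :
    ∫ x, radialSource n r x = 1 := by
  have : Nonempty (Fin n) := ⟨⟨0, hn⟩⟩
  have hβ := unitBallVol_pos n
  have hn' : (0 : ℝ) < n := by exact_mod_cast hn
  have h := integral_fun_norm_addHaar (volume : Measure (Euc n)) fun y : ℝ =>
    2 / (n * unitBallVol n) * (-deriv smoothCutoff (y ^ 2 / r) / r) * (y ^ 2) ^ (1 - (n : ℝ) / 2)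
  simp only [finrank_euclideanSpace_fin] at h
  rw [show (∫ x, radialSource n r x) = _ from h]
  have hint : ∫ y in Set.Ioi (0 : ℝ), y ^ (n - 1) • (2 / (n * unitBallVol n) *
      (-deriv smoothCutoff (y ^ 2 / r) / r) * (y ^ 2) ^ (1 - (n : ℝ) / 2)) =
      ∫ y in Set.Ioi (0 : ℝ), 1 / (n * unitBallVol n) *
        (-(deriv smoothCutoff (y ^ 2 / r) * (2 * y / r))) := by
    refine setIntegral_congr_fun measurableSet_Ioi fun y hy => ?_
    have hy0 : (0 : ℝ) < y := hy
    have hpow : y ^ (n - 1) * (y ^ 2) ^ (1 - (n : ℝ) / 2) = y := by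
      rw [← Real.rpow_natCast, ← Real.rpow_natCast, ← Real.rpow_mul hy0.le, ← Real.rpow_add hy0,
        Nat.cast_sub (by omega)]
      convert Real.rpow_one y using 2
      push_cast
      ring
    simp only [smul_eq_mul]
    calc _ = 2 / (n * unitBallVol n) * (-deriv smoothCutoff (y ^ 2 / r) / r) *
          (y ^ (n - 1) * (y ^ 2) ^ (1 - (n : ℝ) / 2)) := by ring
      _ = _ := by rw [hpow]; ring
  have hd : ∀ y ∈ Set.Ici (0 : ℝ), HasDerivAt (fun y : ℝ => -smoothCutoff (y ^ 2 / r))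
      (-(deriv smoothCutoff (y ^ 2 / r) * (2 * y / r))) y := fun y _ => by
    have h2 : HasDerivAt (fun y : ℝ => y ^ 2 / r) (2 * y / r) y := by
      simpa using (hasDerivAt_pow 2 y).div_const r
    exact ((hasDerivAt_smoothCutoff _).comp y h2).neg
  have hlim : Tendsto (fun y : ℝ => -smoothCutoff (y ^ 2 / r)) atTop (𝓝 0) := by
    refine tendsto_const_nhds.congr' ?_
    have ht : Tendsto (fun y : ℝ => y ^ 2 / r) atTop atTop :=
      (tendsto_pow_atTop two_ne_zero).atTop_div_const hr
    filter_upwards [ht.eventually_ge_atTop 2] with y hy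
    rw [smoothCutoff_of_ge hy, neg_zero]
  have hI := integral_Ioi_of_hasDerivAt_of_nonneg' hd (fun y hy => by
    have h1 := neg_nonneg.2 (deriv_smoothCutoff_nonpos (y ^ 2 / r))
    have hy0 : (0 : ℝ) < y := hy
    rw [← neg_mul]
    positivity) hlim
  rw [hint, integral_const_mul, hI, smoothCutoff_of_le (by simp), ← unitBallVol]
  simp only [nsmul_eq_mul, smul_eq_mul]
  field_simp
  norm_num

/-- The radial derivative, in terms of `q = ‖x‖²`, of a regularised Green function. -/
def radialDeriv (n : ℕ) (s S q : ℝ) : ℝ :=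
  -((smoothCutoff (q / S) - smoothCutoff (q / s)) * q ^ (-((n : ℝ) / 2))) / (2 * n * unitBallVol n)

section

variable {n : ℕ} {s S : ℝ}

theorem radialDeriv_of_le (hs : 0 < s) (hsS : s ≤ S) {q : ℝ} (hq : q ≤ s) :
    radialDeriv n s S q = 0 := by
  rw [radialDeriv, smoothCutoff_of_le ((div_le_one hs).2 hq),
    smoothCutoff_of_le ((div_le_one (hs.trans_le hsS)).2 (hq.trans hsS))]
  simp

theorem radialDeriv_of_ge (hs : 0 < s) (hsS : s ≤ S) {q : ℝ} (hq : 2 * S ≤ q) :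
    radialDeriv n s S q = 0 := by
  rw [radialDeriv, smoothCutoff_of_ge ((le_div_iff₀ hs).2 (by linarith)),
    smoothCutoff_of_ge ((le_div_iff₀ (hs.trans_le hsS)).2 hq)]
  simp

theorem smoothCutoff_sub_nonneg (hs : 0 < s) (hsS : s ≤ S) {q : ℝ} (hq : 0 ≤ q) :
    0 ≤ smoothCutoff (q / S) - smoothCutoff (q / s) :=
  sub_nonneg.2 (smoothCutoff_antitone (div_le_div_of_nonneg_left hq hs hsS))

theorem smoothCutoff_sub_le_one (q : ℝ) : smoothCutoff (q / S) - smoothCutoff (q / s) ≤ 1 := by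
  linarith [smoothCutoff_le_one (q / S), smoothCutoff_nonneg (q / s)]

theorem radialDeriv_nonpos (hs : 0 < s) (hsS : s ≤ S) {q : ℝ} (hq : 0 ≤ q) :
    radialDeriv n s S q ≤ 0 := by
  have h1 := unitBallVol_pos n
  have h2 := smoothCutoff_sub_nonneg hs hsS hq
  rw [radialDeriv, neg_div, neg_nonpos]
  positivity

theorem radialDeriv_contDiff (hs : 0 < s) (hsS : s ≤ S) :
    ContDiff ℝ (⊤ : ℕ∞) (radialDeriv n s S) := by
  rw [contDiff_iff_contDiffAt]
  intro q
  rcases lt_or_ge q s with hq | hq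
  · have : radialDeriv n s S =ᶠ[𝓝 q] fun _ => 0 := by
      filter_upwards [gt_mem_nhds hq] with y hy using radialDeriv_of_le hs hsS (le_of_lt hy)
    exact contDiffAt_const.congr_of_eventuallyEq this
  · have hc : ∀ r : ℝ, ContDiff ℝ (⊤ : ℕ∞) fun q : ℝ => smoothCutoff (q / r) := fun r =>
      smoothCutoff_contDiff.comp (contDiff_id.div_const r)
    exact ((((hc S).sub (hc s)).contDiffAt.mul
      (Real.contDiffAt_rpow_const_of_ne (hs.trans_le hq).ne')).neg).div_const _

theorem hasDerivAt_radialDeriv (q : ℝ) (hq : 0 < q) :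
    HasDerivAt (radialDeriv n s S)
      (-((deriv smoothCutoff (q / S) * (1 / S) - deriv smoothCutoff (q / s) * (1 / s)) *
        q ^ (-((n : ℝ) / 2)) + (smoothCutoff (q / S) - smoothCutoff (q / s)) *
          (-((n : ℝ) / 2) * q ^ (-((n : ℝ) / 2) - 1))) / (2 * n * unitBallVol n)) q := by
  have hc : ∀ r : ℝ, HasDerivAt (fun q : ℝ => smoothCutoff (q / r))
      (deriv smoothCutoff (q / r) * (1 / r)) q := fun r =>
    (hasDerivAt_smoothCutoff _).comp q ((hasDerivAt_id q).div_const r)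
  exact ((((hc S).sub (hc s)).mul (Real.hasDerivAt_rpow_const (Or.inl hq.ne'))).neg).div_const _

/-- A regularised Green function of a ball, in terms of `q = ‖x‖²`. -/
def radialPrimitive (n : ℕ) (s S q : ℝ) : ℝ := ∫ r in (2 * S)..q, radialDeriv n s S r

theorem hasDerivAt_radialPrimitive (hs : 0 < s) (hsS : s ≤ S) (q : ℝ) :
    HasDerivAt (radialPrimitive n s S) (radialDeriv n s S q) q := by
  have hc := (radialDeriv_contDiff (n := n) hs hsS).continuous
  exact intervalIntegral.integral_hasDerivAt_right (hc.intervalIntegrable _ _)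
    (hc.stronglyMeasurableAtFilter _ _) hc.continuousAt

theorem radialPrimitive_contDiff (hs : 0 < s) (hsS : s ≤ S) :
    ContDiff ℝ (⊤ : ℕ∞) (radialPrimitive n s S) := by
  have h := hasDerivAt_radialPrimitive (n := n) hs hsS
  refine contDiff_infty_iff_deriv.2 ⟨fun q => (h q).differentiableAt, ?_⟩
  rw [show deriv (radialPrimitive n s S) = radialDeriv n s S from funext fun q => (h q).deriv]
  exact radialDeriv_contDiff hs hsS

theorem radialPrimitive_of_ge (hs : 0 < s) (hsS : s ≤ S) {q : ℝ} (hq : 2 * S ≤ q) :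
    radialPrimitive n s S q = 0 := by
  rw [radialPrimitive, intervalIntegral.integral_congr (g := fun _ => 0),
    intervalIntegral.integral_zero]
  intro r hr
  rw [Set.uIcc_of_le hq] at hr
  exact radialDeriv_of_ge hs hsS hr.1

theorem radialPrimitive_antitoneOn (hs : 0 < s) (hsS : s ≤ S) :
    AntitoneOn (radialPrimitive n s S) (Set.Ici 0) := by
  refine antitoneOn_of_deriv_nonpos (convex_Ici 0)
    (radialPrimitive_contDiff hs hsS).continuous.continuousOn
    (fun q _ => (hasDerivAt_radialPrimitive hs hsS q).differentiableAt.differentiableWithinAt)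
    fun q hq => ?_
  rw [interior_Ici] at hq
  rw [(hasDerivAt_radialPrimitive hs hsS q).deriv]
  exact radialDeriv_nonpos hs hsS (le_of_lt hq)

theorem radialPrimitive_nonneg (hs : 0 < s) (hsS : s ≤ S) {q : ℝ} (hq : 0 ≤ q) :
    0 ≤ radialPrimitive n s S q := by
  rcases le_total (2 * S) q with h | h
  · exact (radialPrimitive_of_ge hs hsS h).ge
  · rw [← radialPrimitive_of_ge (n := n) hs hsS le_rfl]
    exact radialPrimitive_antitoneOn hs hsS hq (hq.trans h) h

theorem radialPrimitive_le (hs : 0 < s) (hsS : s ≤ S) {q₀ q : ℝ} (hq₀ : 0 < q₀) (hq : q₀ ≤ q) :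
    radialPrimitive n s S q ≤ 2 * S * (q₀ ^ (-((n : ℝ) / 2)) / (2 * n * unitBallVol n)) := by
  have hS := hs.trans_le hsS
  have hβ := unitBallVol_pos n
  set C := q₀ ^ (-((n : ℝ) / 2)) / (2 * n * unitBallVol n) with hC
  have hC0 : 0 ≤ C := by positivity
  rcases le_total (2 * S) q with h | h
  · rw [radialPrimitive_of_ge hs hsS h]; positivity
  · rw [radialPrimitive, intervalIntegral.integral_symm, ← intervalIntegral.integral_neg]
    have hc := (radialDeriv_contDiff (n := n) hs hsS).continuous
    calc ∫ r in q..(2 * S), -radialDeriv n s S r ≤ ∫ _ in q..(2 * S), C := by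
          refine intervalIntegral.integral_mono_on h (hc.neg.intervalIntegrable _ _) (by simp)
            fun r hr => ?_
          have hr0 : 0 < r := hq₀.trans_le (hq.trans hr.1)
          rw [radialDeriv, neg_div, neg_neg, hC]
          gcongr
          have h1 : r ^ (-((n : ℝ) / 2)) ≤ q₀ ^ (-((n : ℝ) / 2)) :=
            Real.rpow_le_rpow_of_nonpos hq₀ (hq.trans hr.1) (by
              rw [neg_nonpos]; positivity)
          calc _ ≤ 1 * r ^ (-((n : ℝ) / 2)) := by
                gcongr; exact smoothCutoff_sub_le_one r
            _ ≤ _ := by rwa [one_mul]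
      _ = (2 * S - q) * C := by simp
      _ ≤ _ := by gcongr; linarith [hq₀.trans_le hq]

end

theorem lapl_sub {n : ℕ} {φ ψ : Euc n → ℝ} (hφ : ContDiff ℝ 2 φ) (hψ : ContDiff ℝ 2 ψ)
    (x : Euc n) : lapl n (fun y => φ y - ψ y) x = lapl n φ x - lapl n ψ x := by
  simp only [lapl, ← Finset.sum_sub_distrib]
  refine Finset.sum_congr rfl fun i _ => ?_
  rw [fun_iteratedFDeriv_sub_apply hφ.contDiffAt hψ.contDiffAt]
  rfl

theorem lapl_comp_sub {n : ℕ} (φ : Euc n → ℝ) (a x : Euc n) :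
    lapl n (fun y => φ (y - a)) x = lapl n φ (x - a) := by
  simp only [lapl, iteratedFDeriv_comp_sub]

/-- The Laplacian of a radial function, written in terms of the squared norm. -/
theorem lapl_comp_norm_sq {n : ℕ} {Θ θ θ' : ℝ → ℝ} (hΘ : ContDiff ℝ 2 Θ)
    (h₁ : ∀ q, HasDerivAt Θ (θ q) q) (x : Euc n) (h₂ : HasDerivAt θ (θ' (‖x‖ ^ 2)) (‖x‖ ^ 2)) :
    lapl n (fun y => Θ (‖y‖ ^ 2)) x = 4 * ‖x‖ ^ 2 * θ' (‖x‖ ^ 2) + 2 * n * θ (‖x‖ ^ 2) := by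
  rw [lapl_eq_sum_fderiv (φ := fun y => Θ (‖y‖ ^ 2)) (hΘ.comp (contDiff_norm_sq ℝ))]
  have hsq : ∀ y : Euc n, HasFDerivAt (fun y : Euc n => ‖y‖ ^ 2) (2 • innerSL ℝ y) y := fun y =>
    (hasStrictFDerivAt_norm_sq y).hasFDerivAt
  have hf : ∀ i (y : Euc n), fderiv ℝ (fun y : Euc n => Θ (‖y‖ ^ 2)) y (EuclideanSpace.single i 1) =
      θ (‖y‖ ^ 2) * (2 * y i) := fun i y => by
    have h : HasFDerivAt (fun y : Euc n => Θ (‖y‖ ^ 2)) _ y := (h₁ _).comp_hasFDerivAt y (hsq y)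
    rw [h.fderiv]
    simp [EuclideanSpace.inner_single_right]
  have hs : ∀ i, fderiv ℝ (fun y : Euc n => θ (‖y‖ ^ 2) * (2 * y i)) x
      (EuclideanSpace.single i 1) = 4 * θ' (‖x‖ ^ 2) * (x i * x i) + 2 * θ (‖x‖ ^ 2) := fun i => by
    have hp : HasFDerivAt (fun y : Euc n => 2 * y i)
        ((2 : ℝ) • (EuclideanSpace.proj i : Euc n →L[ℝ] ℝ)) x :=
      (EuclideanSpace.proj i : Euc n →L[ℝ] ℝ).hasFDerivAt.const_mul 2
    have h : HasFDerivAt (fun y : Euc n => θ (‖y‖ ^ 2) * (2 * y i)) _ x :=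
      (h₂.comp_hasFDerivAt x (hsq x)).mul hp
    rw [h.fderiv]
    simp [EuclideanSpace.inner_single_right]
    ring
  simp_rw [hf, hs]
  rw [Finset.sum_add_distrib, ← Finset.mul_sum, EuclideanSpace.norm_sq_eq]
  simp [← sq]
  ring

section

variable {n : ℕ} {s S : ℝ}

theorem lapl_radialPrimitive (hn : 0 < n) (hs : 0 < s) (hsS : s ≤ S) (x : Euc n) :
    lapl n (fun y => radialPrimitive n s S (‖y‖ ^ 2)) x =
      radialSource n S x - radialSource n s x := by
  have hβ := unitBallVol_pos n
  have hn' : (0 : ℝ) < n := by exact_mod_cast hn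
  have hd := (radialDeriv_contDiff (n := n) hs hsS).differentiable (by simp)
  rw [lapl_comp_norm_sq ((radialPrimitive_contDiff hs hsS).of_le (WithTop.coe_le_coe.2 le_top))
    (hasDerivAt_radialPrimitive hs hsS) x (hd _).hasDerivAt]
  rcases lt_or_ge (‖x‖ ^ 2) s with hx | hx
  · have : radialDeriv n s S =ᶠ[𝓝 (‖x‖ ^ 2)] fun _ => 0 := by
      filter_upwards [gt_mem_nhds hx] with y hy using radialDeriv_of_le hs hsS (le_of_lt hy)
    rw [this.deriv_eq, deriv_const, radialDeriv_of_le hs hsS hx.le, radialSource_of_lt n hs hx,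
      radialSource_of_lt n (hs.trans_le hsS) (hx.trans_le hsS)]
    simp
  · have hq : 0 < ‖x‖ ^ 2 := hs.trans_le hx
    rw [(hasDerivAt_radialDeriv _ hq).deriv, radialDeriv, radialSource, radialSource]
    generalize ‖x‖ ^ 2 = q at *
    have e1 : q ^ (1 - (n : ℝ) / 2) = q * q ^ (-((n : ℝ) / 2)) := by
      rw [sub_eq_add_neg, Real.rpow_add hq, Real.rpow_one]
    have e2 : q ^ (-((n : ℝ) / 2) - 1) = q ^ (-((n : ℝ) / 2)) / q := by
      rw [Real.rpow_sub hq, Real.rpow_one]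
    have hS := hs.trans_le hsS
    rw [e1, e2]
    field_simp
    ring

theorem hasDerivAt_NstarV_rpow (hn : 2 ≤ n) (hS : 0 < S) {q : ℝ} (hq : 0 < q) :
    HasDerivAt (fun q => NstarV n (unitBallVol n * S ^ ((n : ℝ) / 2))
      (unitBallVol n * q ^ ((n : ℝ) / 2)))
      (-q ^ (-((n : ℝ) / 2)) / (2 * n * unitBallVol n)) q := by
  have hβ := unitBallVol_pos n
  have hiso := isoConst_pos (show 0 < n by omega)
  have hn0 : (0 : ℝ) < n := by exact_mod_cast (show 0 < n by omega)
  suffices h : HasDerivAt (fun q => isoConst n * NstarV n (unitBallVol n * S ^ ((n : ℝ) / 2))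
      (unitBallVol n * q ^ ((n : ℝ) / 2)))
      (isoConst n * (-q ^ (-((n : ℝ) / 2)) / (2 * n * unitBallVol n))) q by
    have := h.const_mul (isoConst n)⁻¹
    simpa only [inv_mul_cancel_left₀ hiso.ne'] using this
  rcases hn.eq_or_lt with rfl | hn3
  · have hd : HasDerivAt (fun q => Real.log S - Real.log q) (0 - q⁻¹) q :=
      (hasDerivAt_const _ _).sub (Real.hasDerivAt_log hq.ne')
    refine HasDerivAt.congr_deriv (hd.congr_of_eventuallyEq ?_) ?_
    rotate_left
    · rw [isoConst]
      norm_num [Real.rpow_neg_one]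
      field_simp
    · filter_upwards [lt_mem_nhds hq] with y hy
      rw [isoConst_two_mul_NstarV]
      norm_num
      rw [mul_div_mul_left _ _ hβ.ne', Real.log_div hS.ne' (ne_of_gt hy)]
  · have hn3' : (3 : ℝ) ≤ n := by exact_mod_cast hn3
    have hn2 : (0 : ℝ) < n - 2 := by linarith
    simp_rw [isoConst_mul_NstarV hn3]
    have hd : HasDerivAt (fun q : ℝ => (unitBallVol n ^ (-(((n : ℝ) - 2) / n)) *
        q ^ (-(((n : ℝ) - 2) / 2)) - (unitBallVol n * S ^ ((n : ℝ) / 2)) ^ (-(((n : ℝ) - 2) / n))) /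
        (((n : ℝ) - 2) / n)) (unitBallVol n ^ (-(((n : ℝ) - 2) / n)) *
        (-(((n : ℝ) - 2) / 2) * q ^ (-(((n : ℝ) - 2) / 2) - 1)) / (((n : ℝ) - 2) / n)) q :=
      (((Real.hasDerivAt_rpow_const (Or.inl hq.ne')).const_mul _).sub_const _).div_const _
    refine HasDerivAt.congr_deriv (hd.congr_of_eventuallyEq ?_) ?_
    rotate_left
    · have e1 : -(((n : ℝ) - 2) / 2) - 1 = -((n : ℝ) / 2) := by ring
      have e2 : unitBallVol n ^ (-(((n : ℝ) - 2) / n)) =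
          unitBallVol n ^ (2 / (n : ℝ)) / unitBallVol n := by
        rw [← Real.rpow_sub_one hβ.ne']
        congr 1
        field_simp
        ring
      rw [e1, e2, isoConst]
      field_simp
    · filter_upwards [lt_mem_nhds hq] with y hy
      have hy0 : 0 < y := hy
      rw [Real.mul_rpow hβ.le (by positivity), ← Real.rpow_mul hy0.le]
      congr 4
      field_simp

theorem NstarV_le_radialPrimitive (hn : 2 ≤ n) (hs : 0 < s) {q₀ q : ℝ} (hsq : 2 * s ≤ q₀)
    (hqS : q₀ ≤ S) (hq : 0 ≤ q) (hqq : q ≤ q₀) :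
    NstarV n (unitBallVol n * S ^ ((n : ℝ) / 2)) (unitBallVol n * q₀ ^ ((n : ℝ) / 2)) ≤
      radialPrimitive n s S q := by
  have hS : 0 < S := by linarith
  have hsS : s ≤ S := by linarith
  have hβ := unitBallVol_pos n
  refine le_trans ?_ (radialPrimitive_antitoneOn hs hsS hq (hq.trans hqq) hqq)
  set E := fun q => NstarV n (unitBallVol n * S ^ ((n : ℝ) / 2)) (unitBallVol n * q ^ ((n : ℝ) / 2))
    with hE
  have hd : ∀ r ∈ Set.Icc q₀ S, HasDerivAt (fun r => radialPrimitive n s S r - E r) 0 r := by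
    intro r hr
    have hr0 : 0 < r := by linarith [hr.1]
    refine ((hasDerivAt_radialPrimitive (n := n) hs hsS r).sub
      (hasDerivAt_NstarV_rpow hn hS hr0)).congr_deriv ?_
    rw [radialDeriv, smoothCutoff_of_le ((div_le_one hS).2 hr.2),
      smoothCutoff_of_ge ((le_div_iff₀ hs).2 (by linarith [hr.1]))]
    ring
  have hanti : AntitoneOn (fun r => radialPrimitive n s S r - E r) (Set.Icc q₀ S) :=
    antitoneOn_of_deriv_nonpos (convex_Icc _ _)
      (fun r hr => (hd r hr).continuousAt.continuousWithinAt)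
      (fun r hr => (hd r (interior_subset hr)).differentiableAt.differentiableWithinAt)
      fun r hr => (hd r (interior_subset hr)).deriv.le
  have h := hanti (Set.left_mem_Icc.2 hqS) (Set.right_mem_Icc.2 hqS) hqS
  have hES : E S = 0 := NstarV_self n (by positivity)
  have h0 := radialPrimitive_nonneg (n := n) hs hsS hS.le
  simp only [hES] at h
  linarith

end

theorem tendsto_integral_abs_sub_comp_sub {n : ℕ} {F : Euc n → ℝ} (hF : Continuous F)
    (hc : HasCompactSupport F) (p : Euc n) :
    Tendsto (fun q => ∫ x, |F (x - p) - F (x - q)|) (𝓝 p) (𝓝 0) := by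
  obtain ⟨R, hR⟩ := hc.isCompact.isBounded.subset_closedBall 0
  have hzero : ∀ x, R < ‖x‖ → F x = 0 := fun x hx => image_eq_zero_of_notMem_tsupport fun h =>
    hx.not_ge (mem_closedBall_zero_iff.1 (hR h))
  have hcont : Continuous fun q => ∫ x in Metric.closedBall p (R + 1), |F (x - p) - F (x - q)| :=
    continuous_parametric_integral_of_continuous (f := fun q x => |F (x - p) - F (x - q)|)
      (by simp only [Function.uncurry_def]; fun_prop) (isCompact_closedBall _ _)
  have hlim := hcont.tendsto p
  simp only [sub_self, abs_zero, integral_zero] at hlim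
  refine hlim.congr' ?_
  filter_upwards [Metric.ball_mem_nhds p one_pos] with q hq
  refine setIntegral_eq_integral_of_forall_compl_eq_zero fun x hx => ?_
  rw [Metric.mem_closedBall, not_le, dist_eq_norm] at hx
  rw [Metric.mem_ball, dist_eq_norm] at hq
  have h1 : ‖x - p‖ ≤ ‖x - q‖ + ‖q - p‖ := by
    simpa using norm_add_le (x - q) (q - p)
  rw [hzero _ (by linarith), hzero (x - q) (by linarith), sub_zero, abs_zero]

/-- Test functions that behave like a difference of two Green functions with nearby poles. -/
theorem exists_isTestFun_dipole {n : ℕ} (hn : 2 ≤ n) {Ω : Set (Euc n)} (hΩo : IsOpen Ω)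
    (hΩne : Ω.Nonempty) {ε : ℝ} (hε : 0 < ε) :
    ∃ W > 0, ∃ C : ℝ, ∃ r₀ > 0, ∀ r, 0 < r → r < r₀ → ∃ u, IsTestFun n Ω u ∧
      ∫ x, |lapl n u x| ≤ 2 + ε ∧ ∃ p q, Disjoint (Metric.ball p r) (Metric.ball q r) ∧
        Metric.ball p r ∪ Metric.ball q r ⊆ Ω ∧ ∀ z ∈ Metric.ball p r ∪ Metric.ball q r,
          NstarV n W (unitBallVol n * r ^ n) - C ≤ |u z| := by
  have hn0 : 0 < n := by omega
  have : Nonempty (Fin n) := ⟨⟨0, hn0⟩⟩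
  have hβ := unitBallVol_pos n
  obtain ⟨p, hp⟩ := hΩne
  obtain ⟨ρ, hρ, hρΩ⟩ := Metric.isOpen_iff.1 hΩo p hp
  set S := ρ ^ 2 / 8 with hS
  have hS0 : 0 < S := by positivity
  have hFc := radialSource_continuous n hS0
  have hlim := tendsto_integral_abs_sub_comp_sub hFc (radialSource_hasCompactSupport n hS0) p
  obtain ⟨q, ⟨hqε, hqρ⟩, hqp⟩ := (((hlim.eventually (gt_mem_nhds hε)).and
    (Metric.ball_mem_nhds p (show 0 < ρ / 4 by positivity))).filter_mono nhdsWithin_le_nhds |>.and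
    (self_mem_nhdsWithin : {p}ᶜ ∈ 𝓝[≠] p)).exists
  set d := dist q p with hd
  have hd0 : 0 < d := dist_pos.2 hqp
  have hdρ : d < ρ / 4 := hqρ
  refine ⟨unitBallVol n * S ^ ((n : ℝ) / 2), by positivity,
    2 * S * (((d / 2) ^ 2) ^ (-((n : ℝ) / 2)) / (2 * n * unitBallVol n)), d / 2, by positivity,
    fun r hr hrd => ?_⟩
  set C := 2 * S * (((d / 2) ^ 2) ^ (-((n : ℝ) / 2)) / (2 * n * unitBallVol n)) with hC
  set s := r ^ 2 / 2 with hs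
  have hs0 : 0 < s := by positivity
  have hrS : r ^ 2 ≤ S := by rw [hS]; nlinarith
  have hsS : s ≤ S := by linarith [sq_nonneg r]
  set w : Euc n → ℝ := fun x => radialPrimitive n s S (‖x‖ ^ 2) with hw
  have hwC : ContDiff ℝ (⊤ : ℕ∞) w := (radialPrimitive_contDiff hs0 hsS).comp (contDiff_norm_sq ℝ)
  have hwt : ∀ a : Euc n, ContDiff ℝ (⊤ : ℕ∞) fun x => w (x - a) := fun a =>
    hwC.comp (contDiff_id.sub contDiff_const)
  have hwt2 : ∀ a : Euc n, ContDiff ℝ 2 fun x => w (x - a) := fun a =>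
    (hwt a).of_le (WithTop.coe_le_coe.2 le_top)
  have hw0 : ∀ x, ρ / 2 ≤ ‖x‖ → w x = 0 := fun x hx =>
    radialPrimitive_of_ge hs0 hsS (by rw [hS]; nlinarith)
  have hwlow : ∀ x, ‖x‖ < r →
      NstarV n (unitBallVol n * S ^ ((n : ℝ) / 2)) (unitBallVol n * r ^ n) ≤ w x := fun x hx => by
    have h := NstarV_le_radialPrimitive hn hs0 (show 2 * s ≤ r ^ 2 by rw [hs]; linarith) hrS
      (sq_nonneg ‖x‖) (by gcongr)
    rwa [← Real.rpow_natCast r 2, ← Real.rpow_mul hr.le, Nat.cast_two,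
      mul_div_cancel₀ _ (two_ne_zero' ℝ), Real.rpow_natCast] at h
  have hwup : ∀ x, d / 2 ≤ ‖x‖ → w x ≤ C := fun x hx =>
    radialPrimitive_le hs0 hsS (by positivity) (by gcongr)
  have hwlap : ∀ x, lapl n w x = radialSource n S x - radialSource n s x :=
    lapl_radialPrimitive hn0 hs0 hsS
  set u : Euc n → ℝ := fun x => w (x - p) - w (x - q) with hu
  have hpq : ∀ x, ‖x - p‖ ≤ ‖x - q‖ + d := fun x => by
    rw [hd, dist_eq_norm]
    simpa using norm_add_le (x - q) (q - p)
  have hqp' : ∀ x, d ≤ ‖x - p‖ + ‖x - q‖ := fun x => by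
    rw [hd, dist_eq_norm, ← norm_neg (x - q)]
    simpa using norm_add_le (x - p) (-(x - q))
  have hsupp : tsupport u ⊆ Metric.closedBall p (3 * ρ / 4) := by
    refine closure_minimal (fun x hx => ?_) Metric.isClosed_closedBall
    by_contra hxp
    rw [Metric.mem_closedBall, not_le, dist_eq_norm] at hxp
    refine hx ?_
    simp only [hu]
    rw [hw0 _ (by linarith), hw0 (x - q) (by linarith [hpq x]), sub_zero]
  have hballq : Metric.ball q r ⊆ Metric.ball p ρ :=
    Metric.ball_subset_ball' (by rw [← hd]; linarith)
  refine ⟨u, ⟨(hwt p).sub (hwt q), (isCompact_closedBall _ _).of_isClosed_subset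
    (isClosed_tsupport u) hsupp, hsupp.trans ((Metric.closedBall_subset_ball (by linarith)).trans
    hρΩ)⟩, ?_, p, q, Metric.ball_disjoint_ball (by rw [dist_comm, ← hd]; linarith),
    Set.union_subset ((Metric.ball_subset_ball (by linarith)).trans hρΩ) (hballq.trans hρΩ), ?_⟩
  · have hiS := radialSource_integrable n hS0
    have his := radialSource_integrable n hs0
    have hlap : ∀ x, |lapl n u x| ≤ |radialSource n S (x - p) - radialSource n S (x - q)| +
        radialSource n s (x - p) + radialSource n s (x - q) := fun x => by
      rw [hu, lapl_sub (hwt2 p) (hwt2 q), lapl_comp_sub, lapl_comp_sub, hwlap, hwlap]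
      have h1 := radialSource_nonneg n hs0 (x - p)
      have h2 := radialSource_nonneg n hs0 (x - q)
      have h3 := abs_le.1 (le_refl |radialSource n S (x - p) - radialSource n S (x - q)|)
      exact abs_le.2 ⟨by linarith, by linarith⟩
    have hi1 : Integrable fun x => |radialSource n S (x - p) - radialSource n S (x - q)| := (
      (hiS.comp_sub_right p).sub (hiS.comp_sub_right q)).abs
    have hi2 := his.comp_sub_right p
    have hi3 := his.comp_sub_right q
    have hu2 : ContDiff ℝ 2 u := (hwt2 p).sub (hwt2 q)
    calc ∫ x, |lapl n u x| ≤ ∫ x, (|radialSource n S (x - p) - radialSource n S (x - q)| +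
        radialSource n s (x - p) + radialSource n s (x - q)) :=
          integral_mono_of_nonneg (Eventually.of_forall fun _ => abs_nonneg _)
            ((hi1.add hi2).add hi3) (Eventually.of_forall hlap)
      _ = (∫ x, |radialSource n S (x - p) - radialSource n S (x - q)|) + 1 + 1 := by
          rw [integral_add (by exact hi1.add hi2) hi3, integral_add hi1 hi2, integral_sub_right_eq_self,
            integral_sub_right_eq_self, integral_radialSource hn0 hs0]
      _ ≤ 2 + ε := by linarith [le_of_lt hqε]
  · rintro z (hz | hz)
    · rw [Metric.mem_ball, dist_eq_norm] at hz
      have h1 := hwlow _ hz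
      have h2 := hwup (z - q) (by linarith [hqp' z])
      exact le_trans (by simp only [hu]; linarith) (le_abs_self _)
    · rw [Metric.mem_ball, dist_eq_norm] at hz
      have h1 := hwlow _ hz
      have h2 := hwup (z - p) (by linarith [hqp' z])
      exact le_trans (by simp only [hu]; linarith) (neg_le_abs _)

theorem le_decRearr {n : ℕ} {Ω : Set (Euc n)} (hΩ : volume Ω ≠ ∞) {u : Euc n → ℝ} {m t : ℝ}
    (ht : 0 ≤ t) (hu : Continuous u) (hc : HasCompactSupport u)
    (h : t < volume.real {x ∈ Ω | m ≤ |u x|}) : m ≤ decRearr n Ω u t := by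
  obtain ⟨B, hB⟩ := hc.exists_bound_of_continuous hu
  refine le_csInf ⟨B, (norm_nonneg _).trans (hB 0), ?_⟩ fun s hs => ?_
  · have : {x ∈ Ω | B < |u x|} = ∅ := by
      ext x
      simpa using fun _ => hB x
    simp [this]
  · by_contra! hsm
    have hfin : volume {x ∈ Ω | s < |u x|} ≠ ∞ :=
      ((measure_mono (Set.sep_subset _ _)).trans_lt hΩ.lt_top).ne
    have h1 : volume.real {x ∈ Ω | m ≤ |u x|} ≤ volume.real {x ∈ Ω | s < |u x|} :=
      measureReal_mono (fun x hx => ⟨hx.1, hsm.trans_le hx.2⟩) hfin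
    have h2 := ENNReal.toReal_mono ENNReal.ofReal_ne_top hs.2
    rw [← measureReal_def] at h2
    rw [ENNReal.toReal_ofReal ht] at h2
    linarith

theorem isTestFun_memW21Delta0 {n : ℕ} {Ω : Set (Euc n)} {u : Euc n → ℝ} (hu : IsTestFun n Ω u) :
    MemW21Delta0 n Ω u (lapl n u) :=
  ⟨hu.integrable.integrableOn, hu.integrable_lapl.integrableOn, fun _ => u, fun _ => hu,
    by simp, by simp⟩

theorem decRearr_nonneg (n : ℕ) (Ω : Set (Euc n)) (u : Euc n → ℝ) (t : ℝ) :
    0 ≤ decRearr n Ω u t := Real.sInf_nonneg fun _ hs => hs.1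

theorem continuousAt_NstarV (n : ℕ) {V t : ℝ} (hV : 0 < V) (ht : 0 < t) :
    ContinuousAt (NstarV n V) t := by
  have h : ContinuousAt (fun x : ℝ => V / x) t := continuousAt_const.div continuousAt_id ht.ne'
  unfold NstarV
  split_ifs
  · exact continuousAt_const.mul (h.log (by positivity))
  · exact continuousAt_const.mul
      ((Real.continuousAt_rpow_const t _ (Or.inl ht.ne')).sub continuousAt_const)

theorem tendsto_NstarV_atTop {n : ℕ} (hn : 2 ≤ n) {V : ℝ} (hV : 0 < V) :
    Tendsto (NstarV n V) (𝓝[>] 0) atTop := by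
  have hn0 : 0 < n := by omega
  suffices h : Tendsto (fun t => isoConst n * NstarV n V t) (𝓝[>] 0) atTop by
    have := h.const_mul_atTop (inv_pos.2 (isoConst_pos hn0))
    simpa only [inv_mul_cancel_left₀ (isoConst_pos hn0).ne'] using this
  rcases hn.eq_or_lt with rfl | hn3
  · simp_rw [isoConst_two_mul_NstarV, div_eq_mul_inv]
    exact Real.tendsto_log_atTop.comp (tendsto_inv_nhdsGT_zero.const_mul_atTop hV)
  · have hn3' : (3 : ℝ) ≤ n := by exact_mod_cast hn3
    have ha : 0 < ((n : ℝ) - 2) / n := div_pos (by linarith) (by linarith)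
    simp_rw [isoConst_mul_NstarV hn3]
    exact (tendsto_atTop_add_const_right _ _
      (tendsto_rpow_neg_nhdsGT_zero (neg_neg_of_pos ha))).atTop_div_const ha

theorem exists_NstarV_half_eq {n : ℕ} (hn : 2 ≤ n) {V W : ℝ} (hV : 0 < V) (hW : 0 < W) :
    ∃ K : ℝ, ∀ t, 0 < t → NstarV n W (t / 2) = 2 ^ (1 - 2 / (n : ℝ)) * NstarV n V t + K := by
  have hn0 : (0 : ℝ) < n := by exact_mod_cast (show 0 < n by omega)
  have ha : 1 - 2 / (n : ℝ) = ((n : ℝ) - 2) / n := by field_simp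
  rcases hn.eq_or_lt with rfl | hn3
  · refine ⟨1 / (4 * Real.pi) * (Real.log W + Real.log 2 - Real.log V), fun t ht => ?_⟩
    rw [NstarV, NstarV, if_pos rfl, if_pos rfl, Real.log_div hW.ne' (by positivity),
      Real.log_div ht.ne' two_ne_zero, Real.log_div hV.ne' ht.ne']
    norm_num
    ring
  · refine ⟨cConst n * (omegaS n / n) ^ (((n : ℝ) - 2) / n) * (2 ^ (((n : ℝ) - 2) / n) *
      V ^ (-(((n : ℝ) - 2) / n)) - W ^ (-(((n : ℝ) - 2) / n))), fun t ht => ?_⟩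
    rw [NstarV, NstarV, if_neg (by omega), if_neg (by omega), ha, Real.div_rpow ht.le two_pos.le,
      Real.rpow_neg two_pos.le, div_inv_eq_mul]
    ring

/-- The constant in the sharp estimate cannot be lowered. -/
theorem two_rpow_le_of_forall_div_le {n : ℕ} (hn : 2 ≤ n) {Ω : Set (Euc n)} (hΩo : IsOpen Ω)
    (hΩne : Ω.Nonempty) (hΩ : volume Ω ≠ ∞) {A : ℝ} (hA0 : 0 ≤ A)
    (hA : ∀ (u f : Euc n → ℝ) (t : ℝ), MemW21Delta0 n Ω u f → L1norm n Ω f ≠ 0 → 0 < t →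
      t ≤ volume.real Ω → decRearr n Ω u t / (NstarV n (volume.real Ω) t * L1norm n Ω f) ≤ A) :
    2 ^ (-(2 / (n : ℝ))) ≤ A := by
  have hn0 : 0 < n := by omega
  have hβ := unitBallVol_pos n
  set V := volume.real Ω with hVdef
  have hV : 0 < V := ENNReal.toReal_pos (hΩo.measure_pos volume hΩne).ne' hΩ
  have hpow : (2 : ℝ) ^ (1 - 2 / (n : ℝ)) = 2 * 2 ^ (-(2 / (n : ℝ))) := by
    rw [sub_eq_add_neg, Real.rpow_add two_pos, Real.rpow_one]
  have hmul : ∀ (u : Euc n → ℝ) (t M : ℝ), IsTestFun n Ω u → ∫ x, |lapl n u x| ≤ M → 0 < t →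
      t ≤ V → decRearr n Ω u t ≤ A * M * NstarV n V t := by
    intro u t M hu hM ht htV
    have hmem := isTestFun_memW21Delta0 hu
    have hN := NstarV_nonneg hn ht htV
    have hL := L1norm_nonneg Ω (lapl n u)
    have hLM : L1norm n Ω (lapl n u) ≤ M := hu.setIntegral_abs_lapl.trans_le hM
    have hup := hmem.decRearr_le hn hΩo.measurableSet hΩ ht htV
    rcases (mul_nonneg hN hL).eq_or_lt with h0 | h0
    · rw [← hVdef, ← h0, mul_zero] at hup
      exact hup.trans (mul_nonneg (mul_nonneg hA0 (hL.trans hLM)) hN)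
    · have := hA u _ t hmem (right_ne_zero_of_mul h0.ne') ht htV
      rw [div_le_iff₀ h0] at this
      calc _ ≤ A * (NstarV n V t * L1norm n Ω (lapl n u)) := this
        _ ≤ A * (NstarV n V t * M) := by gcongr
        _ = _ := by ring
  have main : ∀ ε : ℝ, 0 < ε → (2 : ℝ) ^ (1 - 2 / (n : ℝ)) ≤ A * (2 + ε) := by
    intro ε hε
    obtain ⟨W, hW, C, r₀, hr₀, H⟩ := exists_isTestFun_dipole hn hΩo hΩne hε
    obtain ⟨K, hK⟩ := exists_NstarV_half_eq hn hV hW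
    have hbound : ∀ r, 0 < r → r < r₀ → 2 ^ (1 - 2 / (n : ℝ)) *
        NstarV n V (2 * (unitBallVol n * r ^ n)) + K - C ≤
          A * (2 + ε) * NstarV n V (2 * (unitBallVol n * r ^ n)) := by
      intro r hr hrr
      obtain ⟨u, hu, hLu, p, q, hpq, hsub, hlow⟩ := H r hr hrr
      set τ := 2 * (unitBallVol n * r ^ n) with hτ
      have hτ0 : 0 < τ := by positivity
      have hτ' : unitBallVol n * r ^ n = τ / 2 := by rw [hτ]; ring
      rw [← hK τ hτ0, ← hτ']
      have hvol : volume.real (Metric.ball p r ∪ Metric.ball q r) = τ := by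
        rw [measureReal_union hpq Metric.isOpen_ball.measurableSet
          Metric.isBounded_ball.measure_lt_top.ne Metric.isBounded_ball.measure_lt_top.ne,
          volume_real_ball n p hr, volume_real_ball n q hr, hτ]
        ring
      have hτV : τ ≤ V := hvol ▸ measureReal_mono hsub hΩ
      have hlim : Tendsto (fun t => A * (2 + ε) * NstarV n V t) (𝓝[<] τ)
          (𝓝 (A * (2 + ε) * NstarV n V τ)) :=
        ((continuousAt_NstarV n hV hτ0).tendsto.const_mul _).mono_left nhdsWithin_le_nhds
      refine ge_of_tendsto hlim ?_
      filter_upwards [Ioo_mem_nhdsLT hτ0] with t ht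
      refine le_trans ?_ (hmul u t _ hu hLu ht.1 (ht.2.le.trans hτV))
      refine le_decRearr hΩ ht.1.le hu.1.continuous hu.2.1 (ht.2.trans_le ?_)
      rw [← hvol]
      exact measureReal_mono (fun z hz => ⟨hsub hz, hlow z hz⟩)
        ((measure_mono (Set.sep_subset _ _)).trans_lt hΩ.lt_top).ne
    by_contra! hlt
    have hτlim : Tendsto (fun r : ℝ => 2 * (unitBallVol n * r ^ n)) (𝓝[>] 0) (𝓝[>] 0) := by
      refine tendsto_nhdsWithin_iff.2 ⟨?_, eventually_nhdsWithin_of_forall fun r hr => ?_⟩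
      · have : Tendsto (fun r : ℝ => 2 * (unitBallVol n * r ^ n)) (𝓝 0)
            (𝓝 (2 * (unitBallVol n * 0 ^ n))) :=
          (by fun_prop : Continuous fun r : ℝ => 2 * (unitBallVol n * r ^ n)).tendsto 0
        rw [zero_pow hn0.ne', mul_zero, mul_zero] at this
        exact this.mono_left nhdsWithin_le_nhds
      · have hr' : (0 : ℝ) < r := hr
        exact Set.mem_Ioi.2 (by positivity)
    obtain ⟨r, hr1, hr2⟩ := ((((tendsto_NstarV_atTop hn hV).comp hτlim).eventually_gt_atTop
      ((C - K) / (2 ^ (1 - 2 / (n : ℝ)) - A * (2 + ε)))).and (Ioo_mem_nhdsGT hr₀)).exists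
    have h1 := hbound r hr2.1 hr2.2
    rw [Function.comp_apply, div_lt_iff₀ (sub_pos.2 hlt)] at hr1
    linarith
  have hlim : Tendsto (fun ε : ℝ => A * (2 + ε)) (𝓝[>] 0) (𝓝 (A * (2 + 0))) :=
    ((by fun_prop : Continuous fun ε : ℝ => A * (2 + ε)).tendsto 0).mono_left nhdsWithin_le_nhds
  have := ge_of_tendsto hlim (eventually_nhdsWithin_of_forall main)
  rw [hpow] at this
  linarith

theorem exists_memW21Delta0_L1norm_ne_zero {n : ℕ} (hn : 2 ≤ n) {Ω : Set (Euc n)}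
    (hΩo : IsOpen Ω) (hΩne : Ω.Nonempty) (hΩ : volume Ω ≠ ∞) :
    ∃ u f : Euc n → ℝ, MemW21Delta0 n Ω u f ∧ L1norm n Ω f ≠ 0 := by
  by_contra! h
  have h2 := two_rpow_le_of_forall_div_le hn hΩo hΩne hΩ le_rfl
    fun u f t hm hL => absurd (h u f hm) hL
  exact h2.not_gt (by positivity)

/-- For Ω ⊆ ℝⁿ (n ≥ 2) open and bounded (nonempty), the supremum of
u*(t)/(N*_{|Ω|}(t) ‖Δu‖₁) over u ∈ W^{2,1}_{Δ,0}(Ω), Δu ≠ 0, and 0 < t ≤ |Ω|,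
equals 2^{-2/n}. -/
theorem stmt_4 (n : ℕ) (hn : 2 ≤ n) (Ω : Set (Euc n)) (hΩo : IsOpen Ω)
    (hΩb : Bornology.IsBounded Ω) (hΩne : Ω.Nonempty) :
    sSup {r : ℝ | ∃ u f : Euc n → ℝ, ∃ t : ℝ,
      MemW21Delta0 n Ω u f ∧ L1norm n Ω f ≠ 0 ∧ 0 < t ∧ t ≤ (volume Ω).toReal ∧
      r = decRearr n Ω u t / (NstarV n (volume Ω).toReal t * L1norm n Ω f)}
      = (2 : ℝ) ^ (-(2 / (n : ℝ))) := by
  have hΩ : volume Ω ≠ ∞ := hΩb.measure_lt_top.ne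
  have hub : ∀ r ∈ {r : ℝ | ∃ u f : Euc n → ℝ, ∃ t : ℝ, MemW21Delta0 n Ω u f ∧
      L1norm n Ω f ≠ 0 ∧ 0 < t ∧ t ≤ (volume Ω).toReal ∧
      r = decRearr n Ω u t / (NstarV n (volume Ω).toReal t * L1norm n Ω f)},
      r ≤ (2 : ℝ) ^ (-(2 / (n : ℝ))) := by
    rintro r ⟨u, f, t, hm, -, ht, htV, rfl⟩
    exact hm.div_le hn hΩo.measurableSet hΩ ht htV
  obtain ⟨u₀, f₀, hm₀, hL₀⟩ := exists_memW21Delta0_L1norm_ne_zero hn hΩo hΩne hΩ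
  refine le_antisymm (csSup_le ⟨_, u₀, f₀, (volume Ω).toReal, hm₀, hL₀,
    ENNReal.toReal_pos (hΩo.measure_pos volume hΩne).ne' hΩ, le_rfl, rfl⟩ hub) ?_
  refine two_rpow_le_of_forall_div_le hn hΩo hΩne hΩ (Real.sSup_nonneg ?_)
    fun u f t hm hL ht htV => le_csSup ⟨_, hub⟩ ⟨u, f, t, hm, hL, ht, htV, rfl⟩
  rintro r ⟨u, f, t, -, -, ht, htV, rfl⟩
  exact div_nonneg (decRearr_nonneg n Ω u t)
    (mul_nonneg (NstarV_nonneg hn ht htV) (L1norm_nonneg Ω f))
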